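/- arXiv:2307.10280 — 2 statements merged into one kernel-verified Lean document; each statement's English description precedes it below -/
import Mathlib

section
/- For a monic polynomial g ∈ F_q[t] of degree r ≥ 1, the number of monic polynomials of degree n that are coprime to g, summed appropriately, gives Φ(g) ≫ |g|/(log_q(deg g) + 1), i.e., there is an absolute constant c > 0 with Φ(g) ≥ c·q^{deg g}/(log_q(deg g) + 1) for all nonconstant g. -/
open Polynomial

/-- Polynomials of degree `< n` divisible by no element of `T`. -/
def siftedSet {F : Type} [Field F] (T : Finset F[X]) (n : ℕ) : Set F[X] :=
  {a | a.degree < (n : WithBot ℕ) ∧ ∀ p ∈ T, ¬ p ∣ a}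

lemma natCard_degreeLT {F : Type} [Field F] [Fintype F] (n : ℕ) :
    Nat.card (degreeLT F n) = Fintype.card F ^ n := by
  rw [Nat.card_congr (degreeLTEquiv F n).toEquiv]
  simp

lemma finite_degreeLT {F : Type} [Field F] [Fintype F] (n : ℕ) :
    ((degreeLT F n : Submodule F F[X]) : Set F[X]).Finite := by
  have : Finite (degreeLT F n) := Finite.of_equiv _ (degreeLTEquiv F n).toEquiv.symm
  exact Set.toFinite _

lemma siftedSet_finite {F : Type} [Field F] [Fintype F] (T : Finset F[X]) (n : ℕ) :
    (siftedSet T n).Finite :=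
  (finite_degreeLT n).subset fun a ha => mem_degreeLT.2 ha.1

lemma siftedSet_card {F : Type} [Field F] [Fintype F] (T : Finset F[X])
    (hm : ∀ p ∈ T, p.Monic) (hi : ∀ p ∈ T, Irreducible p) :
    ∀ n : ℕ, ∑ p ∈ T, p.natDegree ≤ n →
      ((siftedSet T n).ncard : ℝ) =
        (Fintype.card F : ℝ) ^ n * ∏ p ∈ T, (1 - 1 / (Fintype.card F : ℝ) ^ p.natDegree) := by
  classical
  induction T using Finset.induction_on with
  | empty =>
    intro n _
    have : siftedSet (∅ : Finset F[X]) n = ((degreeLT F n : Submodule F F[X]) : Set F[X]) := by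
      ext a
      simp [siftedSet, mem_degreeLT]
    rw [this]
    have h := natCard_degreeLT (F := F) n
    have h2 : ((degreeLT F n : Submodule F F[X]) : Set F[X]).ncard = Fintype.card F ^ n := h
    rw [h2]; simp
  | insert p T hp ih =>
    intro n hn
    rw [Finset.sum_insert hp] at hn
    have ih' := ih (fun x hx => hm x (Finset.mem_insert_of_mem hx))
      (fun x hx => hi x (Finset.mem_insert_of_mem hx))
    have hpm : p.Monic := hm p (Finset.mem_insert_self _ _)
    have hpi : Irreducible p := hi p (Finset.mem_insert_self _ _)
    have hp0 : p ≠ 0 := hpm.ne_zero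
    have hsub : (fun b => p * b) '' siftedSet T (n - p.natDegree) ⊆ siftedSet T n := by
      rintro _ ⟨b, ⟨hb1, hb2⟩, rfl⟩
      refine ⟨?_, ?_⟩
      · by_cases hb : b = 0
        · subst hb
          simp [WithBot.bot_lt_coe]
        have h1 : b.natDegree < n - p.natDegree := (natDegree_lt_iff_degree_lt hb).2 hb1
        have h2 : (p * b).natDegree < n := by
          rw [natDegree_mul hp0 hb]; omega
        exact (natDegree_lt_iff_degree_lt (mul_ne_zero hp0 hb)).1 h2
      · intro r hr hdiv
        have hri : Irreducible r := hi r (Finset.mem_insert_of_mem hr)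
        rcases hri.prime.dvd_or_dvd hdiv with h | h
        · have hass : Associated r p := hri.associated_of_dvd hpi h
          have : r = p := eq_of_monic_of_associated (hm r (Finset.mem_insert_of_mem hr)) hpm hass
          exact hp (this ▸ hr)
        · exact hb2 r hr h
    have heq : siftedSet (insert p T) n =
        siftedSet T n \ (fun b => p * b) '' siftedSet T (n - p.natDegree) := by
      ext a
      constructor
      · rintro ⟨h1, h2⟩
        refine ⟨⟨h1, fun r hr => h2 r (Finset.mem_insert_of_mem hr)⟩, ?_⟩
        rintro ⟨b, _, rfl⟩
        exact h2 p (Finset.mem_insert_self _ _) (dvd_mul_right p b)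
      · rintro ⟨⟨h1, h2⟩, h3⟩
        refine ⟨h1, fun r hr => ?_⟩
        rcases Finset.mem_insert.1 hr with rfl | hr
        · rintro ⟨b, rfl⟩
          refine h3 ⟨b, ⟨?_, fun s hs hsb => h2 s hs (hsb.mul_left _)⟩, rfl⟩
          by_cases hb : b = 0
          · subst hb
            simp [WithBot.bot_lt_coe]
          have h4 : (r * b).natDegree < n :=
            (natDegree_lt_iff_degree_lt (mul_ne_zero hp0 hb)).2 h1
          rw [natDegree_mul hp0 hb] at h4
          exact (natDegree_lt_iff_degree_lt hb).1 (by omega)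
        · exact h2 r hr
    have hinj : Function.Injective (fun b : F[X] => p * b) := mul_right_injective₀ hp0
    have hc := Set.ncard_sdiff_add_ncard_of_subset hsub (siftedSet_finite T n)
    rw [← heq, Set.ncard_image_of_injective _ hinj] at hc
    have hc' : ((siftedSet (insert p T) n).ncard : ℝ) +
        ((siftedSet T (n - p.natDegree)).ncard : ℝ) = ((siftedSet T n).ncard : ℝ) := by
      exact_mod_cast hc
    rw [ih' n (by omega), ih' (n - p.natDegree) (by omega)] at hc'
    rw [Finset.prod_insert hp, eq_sub_of_add_eq hc']
    have hq : (Fintype.card F : ℝ) ≠ 0 := by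
      exact_mod_cast Fintype.card_ne_zero
    have hpow : (Fintype.card F : ℝ) ^ n =
        (Fintype.card F : ℝ) ^ (n - p.natDegree) * (Fintype.card F : ℝ) ^ p.natDegree := by
      rw [← pow_add]; congr 1; omega
    rw [hpow]
    have := pow_ne_zero p.natDegree hq
    field_simp

lemma prod_dvd_of_monic_irreducible {F : Type} [Field F] (T : Finset F[X])
    (hm : ∀ p ∈ T, p.Monic) (hi : ∀ p ∈ T, Irreducible p) (g : F[X])
    (hd : ∀ p ∈ T, p ∣ g) : ∏ p ∈ T, p ∣ g := by
  refine Finset.prod_dvd_of_coprime ?_ hd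
  intro a ha b hb hab
  refine (hi a ha).coprime_iff_not_dvd.2 fun h => hab ?_
  exact eq_of_monic_of_associated (hm a ha) (hm b hb) ((hi a ha).associated_of_dvd (hi b hb) h)

lemma sum_natDegree_le {F : Type} [Field F] (T : Finset F[X])
    (hm : ∀ p ∈ T, p.Monic) (hi : ∀ p ∈ T, Irreducible p) (g : F[X]) (hg : g ≠ 0)
    (hd : ∀ p ∈ T, p ∣ g) : ∑ p ∈ T, p.natDegree ≤ g.natDegree := by
  have h := natDegree_le_of_dvd (prod_dvd_of_monic_irreducible T hm hi g hd) hg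
  rwa [natDegree_prod_of_monic _ _ hm] at h

lemma card_degree_mul_le {F : Type} [Field F] [Fintype F] (T : Finset F[X])
    (hm : ∀ p ∈ T, p.Monic) (hi : ∀ p ∈ T, Irreducible p) (d : ℕ) (hd0 : d ≠ 0)
    (hd : ∀ p ∈ T, p.natDegree = d) : T.card * d ≤ Fintype.card F ^ d := by
  have hq : 1 < Fintype.card F := Fintype.one_lt_card
  have h := sum_natDegree_le T hm hi (X ^ (Fintype.card F) ^ d - X)
    (FiniteField.X_pow_card_pow_sub_X_ne_zero _ hd0 hq) (fun p hp => by
      have := (hi p hp).natDegree_dvd_iff_dvd_X_pow_card_pow_sub_X (n := d)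
      rw [Nat.card_eq_fintype_card] at this
      exact this.1 (by rw [hd p hp]))
  rw [FiniteField.X_pow_card_pow_sub_X_natDegree_eq _ hd0 hq, Finset.sum_congr rfl hd] at h
  simpa using h

lemma sum_inv_le {F : Type} [Field F] [Fintype F] (T : Finset F[X])
    (hm : ∀ p ∈ T, p.Monic) (hi : ∀ p ∈ T, Irreducible p) (r m : ℕ) (hm1 : 1 ≤ m)
    (hr : ∑ p ∈ T, p.natDegree ≤ r) (hrm : r ≤ Fintype.card F ^ m) :
    ∑ p ∈ T, 1 / ((Fintype.card F : ℝ) ^ p.natDegree - 1) ≤ 4 + Real.log m := by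
  classical
  have hq : 2 ≤ Fintype.card F := Fintype.one_lt_card
  set q : ℝ := (Fintype.card F : ℝ) with hqdef
  have hq2 : (2 : ℝ) ≤ q := by rw [hqdef]; exact_mod_cast hq
  have hpos : ∀ p ∈ T, 1 ≤ p.natDegree := fun p hp => (hi p hp).natDegree_pos
  rw [← Finset.sum_filter_add_sum_filter_not T (fun p => p.natDegree ≤ m)]
  have hbig : ∑ p ∈ T with ¬ p.natDegree ≤ m, 1 / (q ^ p.natDegree - 1) ≤ 1 := by
    have hqm : 1 ≤ q ^ m := one_le_pow₀ (by linarith)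
    have h1 : ∀ p ∈ T.filter (fun p => ¬ p.natDegree ≤ m),
        1 / (q ^ p.natDegree - 1) ≤ (p.natDegree : ℝ) * (1 / q ^ m) := by
      intro p hp
      rw [Finset.mem_filter] at hp
      have h2 : q ^ (m + 1) ≤ q ^ p.natDegree := pow_le_pow_right₀ (by linarith) (by omega)
      have h3 : q ^ m ≤ q ^ p.natDegree - 1 := by
        rw [pow_succ] at h2; nlinarith
      have h4 : (1 : ℝ) ≤ p.natDegree := by exact_mod_cast hpos p hp.1
      calc 1 / (q ^ p.natDegree - 1) ≤ 1 / q ^ m :=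
            one_div_le_one_div_of_le (by positivity) h3
        _ ≤ _ := le_mul_of_one_le_left (by positivity) h4
    refine (Finset.sum_le_sum h1).trans ?_
    rw [← Finset.sum_mul]
    have h5 : ∑ p ∈ T with ¬ p.natDegree ≤ m, (p.natDegree : ℝ) ≤ q ^ m := by
      have : ∑ p ∈ T with ¬ p.natDegree ≤ m, p.natDegree ≤ Fintype.card F ^ m :=
        ((Finset.sum_le_sum_of_subset (Finset.filter_subset _ _)).trans hr).trans hrm
      rw [hqdef]; exact_mod_cast this
    rw [mul_one_div]
    exact div_le_one_of_le₀ h5 (by positivity)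
  have hsmall : ∑ p ∈ T with p.natDegree ≤ m, 1 / (q ^ p.natDegree - 1) ≤ 3 + Real.log m := by
    have hmaps : ∀ p ∈ T.filter (fun p => p.natDegree ≤ m), p.natDegree ∈ Finset.Icc 1 m := by
      intro p hp
      rw [Finset.mem_filter] at hp
      exact Finset.mem_Icc.2 ⟨hpos p hp.1, hp.2⟩
    rw [← Finset.sum_fiberwise_of_maps_to hmaps]
    have hd : ∀ d ∈ Finset.Icc 1 m,
        ∑ p ∈ (T.filter (fun p => p.natDegree ≤ m)) with p.natDegree = d,
          1 / (q ^ p.natDegree - 1) ≤ (d : ℝ)⁻¹ + 2 * (1 / 2) ^ d := by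
      intro d hd
      have hd1 : 1 ≤ d := (Finset.mem_Icc.1 hd).1
      set S := (T.filter (fun p => p.natDegree ≤ m)).filter (fun p => p.natDegree = d) with hS
      have hST : ∀ p ∈ S, p ∈ T ∧ p.natDegree = d := by
        intro p hp
        simp only [hS, Finset.mem_filter] at hp
        exact ⟨hp.1.1, hp.2⟩
      have hcard := card_degree_mul_le S (fun p hp => hm p (hST p hp).1)
        (fun p hp => hi p (hST p hp).1) d (by omega) (fun p hp => (hST p hp).2)
      have hcard' : (S.card : ℝ) * d ≤ q ^ d := by rw [hqdef]; exact_mod_cast hcard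
      have hsum : ∑ p ∈ S, 1 / (q ^ p.natDegree - 1) = S.card * (1 / (q ^ d - 1)) := by
        rw [Finset.sum_congr rfl (fun p hp => by rw [(hST p hp).2]), Finset.sum_const,
          nsmul_eq_mul]
      rw [hsum]
      have hdR : (1 : ℝ) ≤ d := by exact_mod_cast hd1
      have h2d : (2 : ℝ) ≤ 2 ^ d := le_self_pow₀ (by norm_num) (by omega)
      have hqd : (2 : ℝ) ^ d ≤ q ^ d := pow_le_pow_left₀ (by norm_num) hq2 d
      have hb : 0 < q ^ d - 1 := by linarith
      have e1 : (S.card : ℝ) ≤ q ^ d / d := by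
        rw [le_div_iff₀ (by linarith)]; exact hcard'
      calc (S.card : ℝ) * (1 / (q ^ d - 1)) ≤ q ^ d / d * (1 / (q ^ d - 1)) := by gcongr
        _ = (d : ℝ)⁻¹ + (d : ℝ)⁻¹ * (1 / (q ^ d - 1)) := by
            field_simp
            ring
        _ ≤ (d : ℝ)⁻¹ + 1 * (1 / (2 ^ d / 2)) := by
            gcongr
            · exact inv_le_one_of_one_le₀ hdR
            · linarith
        _ = (d : ℝ)⁻¹ + 2 * (1 / 2) ^ d := by
            rw [one_div_pow]; field_simp
    refine (Finset.sum_le_sum hd).trans ?_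
    rw [Finset.sum_add_distrib, ← Finset.mul_sum]
    have hH : ∑ d ∈ Finset.Icc 1 m, (d : ℝ)⁻¹ ≤ 1 + Real.log m := by
      have := harmonic_le_one_add_log m
      rw [harmonic_eq_sum_Icc] at this
      push_cast at this
      exact this
    have hG : ∑ d ∈ Finset.Icc 1 m, ((1 : ℝ) / 2) ^ d ≤ 1 := by
      have : ∀ k : ℕ, ∑ d ∈ Finset.Icc 1 k, ((1 : ℝ) / 2) ^ d = 1 - (1 / 2) ^ k := by
        intro k
        induction k with
        | zero => simp
        | succ k ih => rw [Finset.sum_Icc_succ_top (by omega), ih]; ring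
      rw [this]
      have : (0 : ℝ) ≤ (1 / 2) ^ m := by positivity
      linarith
    linarith
  linarith

lemma exp_le_one_sub {x : ℝ} (hx : 1 < x) : Real.exp (-(1 / (x - 1))) ≤ 1 - 1 / x := by
  have h := Real.add_one_le_exp (1 / (x - 1))
  have h1 : 0 < x - 1 := by linarith
  have h2 : 1 - 1 / x = (1 / (x - 1) + 1)⁻¹ := by
    field_simp
    ring
  rw [Real.exp_neg, h2]
  exact inv_anti₀ (by positivity) h

/-- There is an absolute constant `c > 0` such that for every nonconstant monic
`g ∈ F_q[t]`, the number `Φ(g)` of residues modulo `g` coprime to `g` satisfies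
`Φ(g) ≥ c·q^{deg g}/(log_q(deg g) + 1)`. -/
theorem phi_lower_bound :
    ∃ c : ℝ, 0 < c ∧
      ∀ (Fq : Type) [Field Fq] [Fintype Fq] (g : Polynomial Fq)
        (U : Finset (Polynomial Fq)),
        g.Monic → 1 ≤ g.natDegree →
        (∀ a, a ∈ U ↔ a.degree < g.degree ∧ IsCoprime a g) →
        c * (Fintype.card Fq : ℝ) ^ g.natDegree /
            (Real.logb (Fintype.card Fq) (g.natDegree : ℝ) + 1) ≤ (U.card : ℝ) := by
  classical
  refine ⟨Real.exp (-4), Real.exp_pos _, ?_⟩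
  intro F _ _ g U hgm hg1 hU
  have hg0 : g ≠ 0 := hgm.ne_zero
  have hq : 1 < Fintype.card F := Fintype.one_lt_card
  have hqR : (1 : ℝ) < Fintype.card F := by exact_mod_cast hq
  let T : Finset F[X] := (UniqueFactorizationMonoid.normalizedFactors g).toFinset
  have hT : ∀ p, p ∈ T ↔ Irreducible p ∧ normalize p = p ∧ p ∣ g := fun p => by
    rw [Multiset.mem_toFinset, UniqueFactorizationMonoid.mem_normalizedFactors_iff' hg0]
  have hi : ∀ p ∈ T, Irreducible p := fun p hp => ((hT p).1 hp).1
  have hd : ∀ p ∈ T, p ∣ g := fun p hp => ((hT p).1 hp).2.2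
  have hm : ∀ p ∈ T, p.Monic := fun p hp => by
    rw [← ((hT p).1 hp).2.1]
    exact monic_normalize (hi p hp).ne_zero
  have hUT : (U : Set F[X]) = siftedSet T g.natDegree := by
    ext a
    rw [Finset.mem_coe, hU, degree_eq_natDegree hg0]
    refine and_congr_right fun _ => ⟨fun h p hp hpa => ?_, fun h => ?_⟩
    · exact (hi p hp).not_isUnit (h.isUnit_of_dvd' hpa (hd p hp))
    · refine isCoprime_of_irreducible_dvd (fun h => hg0 h.2) fun z hz hza hzg => ?_
      refine h (normalize z) ((hT _).2 ⟨?_, normalize_idem z, ?_⟩) ?_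
      · exact (normalize_associated z).symm.irreducible hz
      · exact normalize_dvd_iff.2 hzg
      · exact normalize_dvd_iff.2 hza
  have hsum := sum_natDegree_le T hm hi g hg0 hd
  have hcard := siftedSet_card T hm hi g.natDegree hsum
  rw [← hUT, Set.ncard_coe_finset] at hcard
  rw [hcard]
  set m := Nat.log (Fintype.card F) g.natDegree + 1 with hmdef
  have hS := sum_inv_le T hm hi g.natDegree m (by omega) hsum
    (Nat.lt_pow_succ_log_self hq _).le
  have hmR : (0 : ℝ) < m := by exact_mod_cast Nat.succ_pos _
  have hmL : (m : ℝ) ≤ Real.logb (Fintype.card F) (g.natDegree : ℝ) + 1 := by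
    rw [hmdef]; push_cast
    have := Real.natLog_le_logb g.natDegree (Fintype.card F)
    linarith
  have hprod : Real.exp (-4) / m ≤
      ∏ p ∈ T, (1 - 1 / (Fintype.card F : ℝ) ^ p.natDegree) := by
    calc Real.exp (-4) / m = Real.exp (-(4 + Real.log m)) := by
          rw [neg_add, Real.exp_add, Real.exp_neg (Real.log m), Real.exp_log hmR]; rfl
      _ ≤ Real.exp (∑ p ∈ T, -(1 / ((Fintype.card F : ℝ) ^ p.natDegree - 1))) := by
          apply Real.exp_le_exp.2
          rw [Finset.sum_neg_distrib]
          linarith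
      _ = ∏ p ∈ T, Real.exp (-(1 / ((Fintype.card F : ℝ) ^ p.natDegree - 1))) :=
          Real.exp_sum _ _
      _ ≤ _ := by
          refine Finset.prod_le_prod (fun p _ => (Real.exp_pos _).le) fun p hp => ?_
          exact exp_le_one_sub (one_lt_pow₀ hqR (hi p hp).natDegree_pos.ne')
  calc Real.exp (-4) * (Fintype.card F : ℝ) ^ g.natDegree /
            (Real.logb (Fintype.card F) (g.natDegree : ℝ) + 1)
      ≤ Real.exp (-4) * (Fintype.card F : ℝ) ^ g.natDegree / m := by gcongr
    _ = (Fintype.card F : ℝ) ^ g.natDegree * (Real.exp (-4) / m) := by ring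
    _ ≤ _ := by gcongr
end

section
/- Let 0 < ε < 1/4 and 1 ≤ ℓ ≤ n. For any polynomial b ∈ F_q[t], the number of m-smooth monic polynomials f of degree n whose first ℓ coefficients agree with those of b equals Ψ(n,m)/q^ℓ + O_ε(q^{(1/2+ε)n}·e^{εℓ}), where Ψ(n,m) is the total number of m-smooth monic polynomials of degree n. -/
open Polynomial

lemma sp_exists_place (F : Type) [Field F] :
    ∃ (E : Type) (_ : Field E) (_ : IsAlgClosed E) (_ : Algebra F E) (x : E)
      (V : ValuationSubring E), x ∉ V := by
  let E := AlgebraicClosure (RatFunc F)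
  let _ : Algebra F E := inferInstance
  let x : E := algebraMap (RatFunc F) E RatFunc.X
  let R : Subring E := (integralClosure F E).toSubring
  have hx : x ∉ R := by
    intro h
    have h1 : IsIntegral F x := h
    have h2 : IsIntegral F (RatFunc.X : RatFunc F) :=
      (isIntegral_algebraMap_iff (algebraMap (RatFunc F) E).injective).1 h1
    exact RatFunc.transcendental_X h2.isAlgebraic
  have : IsIntegrallyClosedIn R E :=
    inferInstanceAs (IsIntegrallyClosedIn (integralClosure F E) E)
  obtain ⟨V, -, hV⟩ := Subring.exists_le_valuationSubring_of_isIntegrallyClosedIn hx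
  exact ⟨E, inferInstance, inferInstance, inferInstance, x, V, hV⟩

/-- pole order at infinity of the coordinate function `y_j` -/
def spW (q ℓ j : ℕ) : ℕ := ∑ i ∈ Finset.range j, q ^ (ℓ - 1 - i)

/-- pole order at infinity of a monomial -/
def spWt (q ℓ : ℕ) (a0 : ℕ) (a : Fin ℓ → ℕ) : ℕ :=
  q ^ ℓ * a0 + ∑ j, a j * spW q ℓ (j + 1)

/-- a monomial in the coordinate functions -/
def spM {T : Type*} [CommRing T] (x : T) (y : ℕ → T) (ℓ : ℕ) (a0 : ℕ) (a : Fin ℓ → ℕ) : T :=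
  x ^ a0 * ∏ j : Fin ℓ, y (j + 1) ^ (a j)

lemma spW_succ (q ℓ j : ℕ) (hj : j < ℓ) : q * spW q ℓ (j + 1) = q ^ ℓ + spW q ℓ j := by
  unfold spW
  rw [Finset.mul_sum, Finset.sum_range_succ', add_comm]
  congr 1
  · rw [← pow_succ']
    congr 1; omega
  · apply Finset.sum_congr rfl
    intro i hi
    rw [Finset.mem_range] at hi
    rw [← pow_succ']
    congr 1; omega

lemma spW_mono (q ℓ : ℕ) : Monotone (spW q ℓ) := by
  intro i j h
  exact Finset.sum_le_sum_of_subset (by simpa using h)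

lemma spW_up (q ℓ j : ℕ) (hj : j < ℓ) : spW q (ℓ + 1) (j + 1) = q * spW q ℓ (j + 1) := by
  unfold spW
  rw [Finset.mul_sum]
  apply Finset.sum_congr rfl
  intro i hi
  rw [Finset.mem_range] at hi
  rw [← pow_succ']
  congr 1; omega

lemma spW_last (q ℓ : ℕ) : ∃ s, spW q (ℓ + 1) (ℓ + 1) = q * s + 1 := by
  refine ⟨spW q ℓ ℓ, ?_⟩
  conv_lhs => rw [spW]
  rw [Finset.sum_range_succ]
  congr 1
  · unfold spW
    rw [Finset.mul_sum]
    apply Finset.sum_congr rfl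
    intro i hi
    rw [Finset.mem_range] at hi
    rw [← pow_succ']
    congr 1; omega
  · simp

lemma spW_inj (q : ℕ) (hq : 0 < q) (ℓ : ℕ) : ∀ (a b : Fin ℓ → Fin q),
    (∑ j, (a j : ℕ) * spW q ℓ (j + 1)) ≡ (∑ j, (b j : ℕ) * spW q ℓ (j + 1)) [MOD q ^ ℓ] →
    a = b := by
  induction ℓ with
  | zero => intro a b _; exact Subsingleton.elim _ _
  | succ ℓ ih =>
    intro a b h
    obtain ⟨s, hs⟩ := spW_last q ℓ
    have key : ∀ a : Fin (ℓ + 1) → Fin q,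
        (∑ j, (a j : ℕ) * spW q (ℓ + 1) (j + 1)) =
          q * (∑ j : Fin ℓ, (a j.castSucc : ℕ) * spW q ℓ (j + 1)) +
            (a (Fin.last ℓ) : ℕ) * (q * s + 1) := by
      intro a
      rw [Fin.sum_univ_castSucc, Fin.val_last, hs, Finset.mul_sum]
      congr 1
      apply Finset.sum_congr rfl
      intro j _
      rw [Fin.val_castSucc, spW_up q ℓ j j.2]; ring
    rw [key a, key b] at h
    have hlast : a (Fin.last ℓ) = b (Fin.last ℓ) := by
      have h1 := h.of_dvd (show q ∣ q ^ (ℓ + 1) from dvd_pow_self q (by omega))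
      have key2 : ∀ X A : ℕ, (q * X + A * (q * s + 1)) % q = A % q := by
        intro X A
        rw [show q * X + A * (q * s + 1) = A + q * (X + A * s) by ring, Nat.add_mul_mod_self_left]
      unfold Nat.ModEq at h1
      rw [key2, key2, Nat.mod_eq_of_lt (Fin.is_lt _), Nat.mod_eq_of_lt (Fin.is_lt _)] at h1
      exact Fin.ext h1
    rw [hlast] at h
    have h2 := Nat.ModEq.add_right_cancel' _ h
    rw [pow_succ'] at h2
    have h3 := Nat.ModEq.mul_left_cancel' (by omega) h2
    have h4 := ih (fun j => a j.castSucc) (fun j => b j.castSucc) h3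
    funext j
    refine Fin.lastCases hlast (fun i => ?_) j
    exact congrFun h4 i

/-- the reduced exponents of weight at most `D` -/
def spRed (q ℓ D : ℕ) : Finset (ℕ × (Fin ℓ → Fin q)) :=
  ((Finset.range (D + 1)) ×ˢ Finset.univ).filter
    (fun a => spWt q ℓ a.1 (fun j => (a.2 j : ℕ)) ≤ D)

lemma mem_spRed {q ℓ D : ℕ} (hq : 0 < q) (a : ℕ × (Fin ℓ → Fin q)) :
    a ∈ spRed q ℓ D ↔ spWt q ℓ a.1 (fun j => (a.2 j : ℕ)) ≤ D := by
  unfold spRed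
  simp only [Finset.mem_filter, Finset.mem_product, Finset.mem_range, Finset.mem_univ, and_true,
    and_iff_right_iff_imp]
  intro h
  unfold spWt at h
  have : a.1 ≤ q ^ ℓ * a.1 := Nat.le_mul_of_pos_left _ (by positivity)
  omega

lemma spWt_inj {q ℓ : ℕ} (hq : 0 < q) (a b : ℕ × (Fin ℓ → Fin q))
    (h : spWt q ℓ a.1 (fun j => (a.2 j : ℕ)) = spWt q ℓ b.1 (fun j => (b.2 j : ℕ))) : a = b := by
  unfold spWt at h
  have h2 : a.2 = b.2 := by
    apply spW_inj q hq ℓ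
    have h1 : (q ^ ℓ * a.1 + ∑ j, (a.2 j : ℕ) * spW q ℓ (j + 1)) % q ^ ℓ =
      (q ^ ℓ * b.1 + ∑ j, (b.2 j : ℕ) * spW q ℓ (j + 1)) % q ^ ℓ := by rw [h]
    rwa [Nat.mul_add_mod, Nat.mul_add_mod] at h1
  rw [h2] at h
  have h3 := Nat.eq_of_mul_eq_mul_left (by positivity) (Nat.add_right_cancel h)
  exact Prod.ext h3 h2

lemma card_spRed_le {q ℓ : ℕ} (hq : 0 < q) (D : ℕ) : (spRed q ℓ D).card ≤ D + 1 := by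
  rw [← Finset.card_range (D + 1)]
  apply Finset.card_le_card_of_injOn (fun a => spWt q ℓ a.1 (fun j => (a.2 j : ℕ)))
  · intro a ha
    have := (mem_spRed hq a).1 ha
    simp only [Finset.coe_range, Set.mem_Iio]; omega
  · intro a _ b _ h
    exact spWt_inj hq a b h

/-- the genus-type constant -/
def spG (q ℓ : ℕ) : ℕ := ∑ j : Fin ℓ, q * spW q ℓ (j + 1)

lemma le_card_spRed {q ℓ : ℕ} (hq : 0 < q) (D : ℕ) : D + 1 ≤ (spRed q ℓ D).card + spG q ℓ := by
  have : NeZero (q ^ ℓ) := ⟨by positivity⟩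
  -- all residues are attained
  have hsurj : ∀ n : ℕ, ∃ a : Fin ℓ → Fin q,
      (∑ j, (a j : ℕ) * spW q ℓ (j + 1)) % q ^ ℓ = n % q ^ ℓ := by
    intro n
    let f : (Fin ℓ → Fin q) → Fin (q ^ ℓ) := fun a =>
      ⟨(∑ j, (a j : ℕ) * spW q ℓ (j + 1)) % q ^ ℓ, Nat.mod_lt _ (by positivity)⟩
    have hinj : Function.Injective f := by
      intro a b h
      apply spW_inj q hq ℓ
      exact congrArg Fin.val h
    have hbij : Function.Bijective f := by
      rw [Fintype.bijective_iff_injective_and_card]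
      exact ⟨hinj, by simp⟩
    obtain ⟨a, ha⟩ := hbij.2 ⟨n % q ^ ℓ, Nat.mod_lt _ (by positivity)⟩
    exact ⟨a, congrArg Fin.val ha⟩
  have hle : ∀ a : Fin ℓ → Fin q, ∑ j, (a j : ℕ) * spW q ℓ (j + 1) ≤ spG q ℓ := by
    intro a
    apply Finset.sum_le_sum
    intro j _
    exact Nat.mul_le_mul_right _ (a j).2.le
  have hsub : Finset.Ico (spG q ℓ) (D + 1) ⊆
      (spRed q ℓ D).image (fun a => spWt q ℓ a.1 (fun j => (a.2 j : ℕ))) := by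
    intro n hn
    rw [Finset.mem_Ico] at hn
    obtain ⟨a, ha⟩ := hsurj n
    have h1 := hle a
    have hdvd : q ^ ℓ ∣ n - ∑ j, (a j : ℕ) * spW q ℓ (j + 1) :=
      (Nat.modEq_iff_dvd' (by omega)).1 ha
    obtain ⟨t, ht⟩ := hdvd
    have hw : spWt q ℓ t (fun j => (a j : ℕ)) = n := by
      unfold spWt; beta_reduce; omega
    rw [Finset.mem_image]
    exact ⟨(t, a), (mem_spRed hq _).2 (by simp only [hw]; omega), hw⟩
  have h1 := (Finset.card_le_card hsub).trans Finset.card_image_le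
  rw [Nat.card_Ico] at h1
  omega

section sp_filtration

variable {F : Type} [Field F] {T : Type*} [CommRing T] [Algebra F T]

lemma spWt_add_single (q ℓ a0 : ℕ) (a : Fin ℓ → ℕ) (j : Fin ℓ) (n : ℕ) :
    spWt q ℓ a0 (a + Pi.single j n) = spWt q ℓ a0 a + n * spW q ℓ (j + 1) := by
  unfold spWt
  have : ∑ i : Fin ℓ, (a + Pi.single j n : Fin ℓ → ℕ) i * spW q ℓ (i + 1) =
      ∑ i : Fin ℓ, a i * spW q ℓ (i + 1) + n * spW q ℓ (j + 1) := by
    simp only [Pi.add_apply, add_mul, Finset.sum_add_distrib]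
    congr 1
    rw [Finset.sum_eq_single j]
    · simp
    · intro b _ hb; simp [Pi.single_eq_of_ne hb]
    · simp
  omega

lemma spM_add (x : T) (y : ℕ → T) (ℓ a0 b0 : ℕ) (a b : Fin ℓ → ℕ) :
    spM x y ℓ (a0 + b0) (a + b) = spM x y ℓ a0 a * spM x y ℓ b0 b := by
  unfold spM
  simp only [Pi.add_apply, pow_add, Finset.prod_mul_distrib]
  ring

lemma spWt_add (q ℓ a0 b0 : ℕ) (a b : Fin ℓ → ℕ) :
    spWt q ℓ (a0 + b0) (a + b) = spWt q ℓ a0 a + spWt q ℓ b0 b := by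
  unfold spWt
  simp only [Pi.add_apply, add_mul, Finset.sum_add_distrib]
  ring

lemma spM_single (x : T) (y : ℕ → T) (ℓ : ℕ) (j : Fin ℓ) (n : ℕ) :
    spM x y ℓ 0 (Pi.single j n) = y (j + 1) ^ n := by
  unfold spM
  rw [pow_zero, one_mul, Finset.prod_eq_single j]
  · simp
  · intro b _ hb; simp [Pi.single_eq_of_ne hb]
  · simp

lemma spM_add_single (x : T) (y : ℕ → T) (ℓ a0 : ℕ) (a : Fin ℓ → ℕ) (j : Fin ℓ) (n : ℕ) :
    spM x y ℓ a0 (a + Pi.single j n) = spM x y ℓ a0 a * y (j + 1) ^ n := by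
  rw [← spM_single x y ℓ j n, ← spM_add, add_zero]

/-- The filtration by weight. -/
def spL (F : Type) [Field F] {T : Type*} [CommRing T] [Algebra F T]
    (q ℓ : ℕ) (x : T) (y : ℕ → T) (D : ℕ) : Submodule F T :=
  Submodule.span F {t | ∃ a0 a, spWt q ℓ a0 a ≤ D ∧ t = spM x y ℓ a0 a}

lemma spL_mono (q ℓ : ℕ) (x : T) (y : ℕ → T) {D D' : ℕ} (h : D ≤ D') :
    spL F q ℓ x y D ≤ spL F q ℓ x y D' := by
  apply Submodule.span_mono
  rintro t ⟨a0, a, h1, h2⟩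
  exact ⟨a0, a, h1.trans h, h2⟩

lemma spL_mul (q ℓ : ℕ) (x : T) (y : ℕ → T) {D D' : ℕ} {s t : T}
    (hs : s ∈ spL F q ℓ x y D) (ht : t ∈ spL F q ℓ x y D') :
    s * t ∈ spL F q ℓ x y (D + D') := by
  have h : spL F q ℓ x y D * spL F q ℓ x y D' ≤ spL F q ℓ x y (D + D') := by
    unfold spL
    rw [Submodule.span_mul_span]
    apply Submodule.span_mono
    rintro _ ⟨_, ⟨a0, a, h1, rfl⟩, _, ⟨b0, b, h2, rfl⟩, rfl⟩
    refine ⟨a0 + b0, a + b, ?_, (spM_add x y ℓ a0 b0 a b).symm⟩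
    rw [spWt_add]; omega
  exact h (Submodule.mul_mem_mul hs ht)

lemma spL_M (q ℓ : ℕ) (x : T) (y : ℕ → T) (a0 : ℕ) (a : Fin ℓ → ℕ) :
    spM x y ℓ a0 a ∈ spL F q ℓ x y (spWt q ℓ a0 a) :=
  Submodule.subset_span ⟨a0, a, le_rfl, rfl⟩

lemma spL_one (q ℓ : ℕ) (x : T) (y : ℕ → T) (D : ℕ) : (1 : T) ∈ spL F q ℓ x y D := by
  refine Submodule.subset_span ⟨0, 0, ?_, ?_⟩
  · simp [spWt]
  · simp [spM]

lemma spL_pow (q ℓ : ℕ) (x : T) (y : ℕ → T) {D : ℕ} {s : T}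
    (hs : s ∈ spL F q ℓ x y D) (n : ℕ) : s ^ n ∈ spL F q ℓ x y (n * D) := by
  induction n with
  | zero => simpa using spL_one q ℓ x y 0
  | succ n ih =>
    rw [pow_succ, add_mul, one_mul]
    exact spL_mul q ℓ x y ih hs

lemma spL_prod (q ℓ : ℕ) (x : T) (y : ℕ → T) {ι : Type} (S : Finset ι) (f : ι → T) (D : ι → ℕ)
    (h : ∀ i ∈ S, f i ∈ spL F q ℓ x y (D i)) :
    ∏ i ∈ S, f i ∈ spL F q ℓ x y (∑ i ∈ S, D i) := by
  classical
  induction S using Finset.induction_on with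
  | empty => simpa using spL_one q ℓ x y 0
  | insert i S hi ih =>
    rw [Finset.prod_insert hi, Finset.sum_insert hi]
    exact spL_mul q ℓ x y (h i (Finset.mem_insert_self _ _))
      (ih (fun j hj => h j (Finset.mem_insert_of_mem hj)))

lemma spL_y (q ℓ : ℕ) (x : T) (y : ℕ → T) (hy0 : y 0 = 1) (j : ℕ) (hj : j ≤ ℓ) :
    y j ∈ spL F q ℓ x y (spW q ℓ j) := by
  rcases j with _ | j
  · rw [hy0]; exact spL_one q ℓ x y _
  · have h := spL_M (F := F) q ℓ x y 0 (Pi.single (⟨j, hj⟩ : Fin ℓ) 1)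
    rw [spM_single, pow_one] at h
    have h2 := spWt_add_single q ℓ 0 0 (⟨j, hj⟩ : Fin ℓ) 1
    rw [zero_add] at h2
    rw [h2] at h
    simpa [spWt] using h

/-- translate of the coordinate functions -/
def spTau (F : Type) [Field F] {T : Type*} [CommRing T] [Algebra F T]
    (c : ℕ → F) (y : ℕ → T) (j : ℕ) : T :=
  ∑ i ∈ Finset.range (j + 1), algebraMap F T (c i) * y (j - i)

lemma spL_tau (q ℓ : ℕ) (x : T) (y : ℕ → T) (hy0 : y 0 = 1) (c : ℕ → F) (a0 : ℕ)
    (a : Fin ℓ → ℕ) :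
    spM x (spTau F c y) ℓ a0 a ∈ spL F q ℓ x y (spWt q ℓ a0 a) := by
  have hx : x ∈ spL F q ℓ x y (q ^ ℓ) := by
    have := spL_M (F := F) q ℓ x y 1 0
    simpa [spM, spWt] using this
  have hy : ∀ j ≤ ℓ, spTau F c y j ∈ spL F q ℓ x y (spW q ℓ j) := by
    intro j hj
    unfold spTau
    apply Submodule.sum_mem
    intro i hi
    rw [← Algebra.smul_def]
    apply Submodule.smul_mem
    exact spL_mono q ℓ x y (spW_mono q ℓ (by omega)) (spL_y q ℓ x y hy0 _ (by omega))
  unfold spM spWt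
  apply spL_mul
  · rw [mul_comm]; exact spL_pow q ℓ x y hx a0
  · apply spL_prod
    intro j _
    exact spL_pow q ℓ x y (hy _ j.2) _

/-- Every monomial is a combination of reduced monomials of the same or smaller weight. -/
lemma spL_red (q ℓ : ℕ) (hq : 2 ≤ q) (x : T) (y : ℕ → T) (hy0 : y 0 = 1)
    (hy : ∀ j < ℓ, y (j + 1) ^ q = y (j + 1) - x * y j) (D : ℕ) :
    spL F q ℓ x y D = Submodule.span F
      ((fun a : ℕ × (Fin ℓ → Fin q) => spM x y ℓ a.1 (fun j => (a.2 j : ℕ))) ''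
        (spRed q ℓ D : Set _)) := by
  apply le_antisymm
  · unfold spL
    rw [Submodule.span_le]
    rintro _ ⟨a0, a, hw, rfl⟩
    rw [SetLike.mem_coe]
    induction hs : ∑ j, a j using Nat.strong_induction_on generalizing a0 a with
    | _ s ih =>
    by_cases hred : ∀ j, a j < q
    · apply Submodule.subset_span
      refine ⟨(a0, fun j => ⟨a j, hred j⟩), ?_, rfl⟩
      rw [Finset.mem_coe, mem_spRed (by omega)]
      exact hw
    · push Not at hred
      obtain ⟨j, hj⟩ := hred
      obtain ⟨b, rfl⟩ : ∃ b : Fin ℓ → ℕ, a = b + Pi.single j q := by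
        refine ⟨a - Pi.single j q, ?_⟩
        funext i
        by_cases h : i = j
        · subst h; simp; omega
        · simp [Pi.single_eq_of_ne h]
      have hsum : ∀ (b : Fin ℓ → ℕ) (i : Fin ℓ) (n : ℕ),
          ∑ k, (b + Pi.single i n : Fin ℓ → ℕ) k = (∑ k, b k) + n := by
        intro b i n
        simp [Finset.sum_add_distrib, Finset.sum_pi_single']
      rw [hsum] at hs
      rw [spWt_add_single, spW_succ q ℓ j j.2] at hw
      have hWj := spW_succ q ℓ j j.2
      have hle : spW q ℓ (j + 1) ≤ q * spW q ℓ (j + 1) := Nat.le_mul_of_pos_left _ (by omega)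
      rw [spM_add_single, hy j j.2, mul_sub]
      apply Submodule.sub_mem
      · have := ih ((∑ k, b k) + 1) (by omega) a0 (b + Pi.single j 1)
          (by rw [spWt_add_single]; omega) (hsum _ _ _)
        rwa [spM_add_single, pow_one] at this
      · obtain ⟨j, hjl⟩ := j
        rcases j with _ | j
        · have := ih (∑ k, b k) (by omega) (a0 + 1) b
            (by have h := spWt_add q ℓ a0 1 b 0
                rw [add_zero] at h
                rw [h]
                have h3 : spWt q ℓ 1 (0 : Fin ℓ → ℕ) = q ^ ℓ := by simp [spWt]
                omega) rfl
          have h2 := spM_add x y ℓ a0 1 b 0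
          rw [add_zero] at h2
          have h3 : spM x y ℓ 1 0 = x := by simp [spM]
          rw [h2, h3] at this
          simpa [hy0] using this
        · have hjl' : j < ℓ := by omega
          have := ih ((∑ k, b k) + 1) (by omega) (a0 + 1) (b + Pi.single ⟨j, hjl'⟩ 1)
            (by have h := spWt_add q ℓ a0 1 (b + Pi.single ⟨j, hjl'⟩ 1) 0
                rw [add_zero] at h
                rw [h, spWt_add_single]
                have h3 : spWt q ℓ 1 (0 : Fin ℓ → ℕ) = q ^ ℓ := by simp [spWt]
                simp only at hw ⊢
                omega) (hsum _ _ _)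
          have h2 := spM_add x y ℓ a0 1 (b + Pi.single ⟨j, hjl'⟩ 1) 0
          rw [add_zero] at h2
          have h3 : spM x y ℓ 1 0 = x := by simp [spM]
          rw [h2, h3, spM_add_single] at this
          convert this using 1
          simp only; ring
  · rw [Submodule.span_le]
    rintro _ ⟨a, ha, rfl⟩
    rw [Finset.mem_coe, mem_spRed (by omega)] at ha
    exact Submodule.subset_span ⟨_, _, ha, rfl⟩

end sp_filtration

/-- A reduced polynomial vanishing on a whole fibre vanishes identically. -/
lemma sp_fibre {F : Type} [Field F] [Fintype F] {K : Type} [Field K] [IsAlgClosed K] [Algebra F K]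
    (q : ℕ) (hq : q = Fintype.card F) (α : K) (ℓ : ℕ) :
    ∀ g : (Fin ℓ → Fin q) → K,
      (∀ y : ℕ → K, y 0 = 1 → (∀ j < ℓ, y (j + 1) ^ q = y (j + 1) - α * y j) →
        ∑ a, g a * ∏ j : Fin ℓ, y (j + 1) ^ (a j : ℕ) = 0) → g = 0 := by
  induction ℓ with
  | zero =>
    intro g h
    funext a
    have := h (fun _ => 1) rfl (by simp)
    simpa [Subsingleton.elim a default] using this
  | succ ℓ ih =>
    intro g h
    have hq2 : 2 ≤ q := by rw [hq]; exact Fintype.one_lt_card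
    have key : ∀ b : Fin q, (fun a' : Fin ℓ → Fin q => g (Fin.snoc a' b)) = 0 := by
      suffices hmain : ∀ y : ℕ → K, y 0 = 1 →
          (∀ j < ℓ, y (j + 1) ^ q = y (j + 1) - α * y j) → ∀ b : Fin q,
          ∑ a' : Fin ℓ → Fin q, g (Fin.snoc a' b) * ∏ j : Fin ℓ, y (j + 1) ^ (a' j : ℕ) = 0 by
        intro b
        apply ih
        intro y hy0 hy
        exact hmain y hy0 hy b
      intro y hy0 hy
      set G : Fin q → K := fun b =>
        ∑ a' : Fin ℓ → Fin q, g (Fin.snoc a' b) * ∏ j : Fin ℓ, y (j + 1) ^ (a' j : ℕ) with hG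
      obtain ⟨z, hz⟩ : ∃ z : K, z ^ q = z - α * y ℓ := by
        have hdeg : (X ^ q - X + C (α * y ℓ) : K[X]).degree = (q : ℕ) := by
          rw [sub_add]
          rw [degree_sub_eq_left_of_degree_lt, degree_X_pow]
          rw [degree_X_pow]
          refine lt_of_le_of_lt (degree_sub_le _ _) ?_
          rw [max_lt_iff]
          constructor
          · rw [degree_X]; exact_mod_cast hq2
          · exact lt_of_le_of_lt degree_C_le (by exact_mod_cast (by omega : 0 < q))
        obtain ⟨z, hz⟩ := IsAlgClosed.exists_root (X ^ q - X + C (α * y ℓ) : K[X])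
          (by rw [hdeg]; exact_mod_cast (by omega : q ≠ 0))
        refine ⟨z, ?_⟩
        simp only [IsRoot, eval_add, eval_sub, eval_pow, eval_X, eval_C] at hz
        linear_combination hz
      have hev : ∀ ζ : F, ∑ b : Fin q, G b * (z + algebraMap F K ζ) ^ (b : ℕ) = 0 := by
        intro ζ
        have hfr : (z + algebraMap F K ζ) ^ q = z ^ q + algebraMap F K ζ := by
          obtain ⟨p, hp⟩ := CharP.exists F
          have : Fact p.Prime := ⟨CharP.char_is_prime F p⟩
          have : CharP K p := charP_of_injective_algebraMap (algebraMap F K).injective p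
          have : ExpChar K p := ExpChar.prime Fact.out
          obtain ⟨n, -, hn⟩ := FiniteField.card F p
          have hqn : q = p ^ (n : ℕ) := by rw [hq, hn]
          rw [hqn, add_pow_expChar_pow, ← map_pow, ← hn, FiniteField.pow_card]
        have h1 := h (Function.update y (ℓ + 1) (z + algebraMap F K ζ))
          (by rw [Function.update_of_ne (by omega)]; exact hy0)
          (by
            intro j hj
            rcases Nat.lt_succ_iff_lt_or_eq.1 hj with hj' | rfl
            · rw [Function.update_of_ne (by omega), Function.update_of_ne (by omega)]
              exact hy j hj'
            · rw [Function.update_self, Function.update_of_ne (by omega), hfr, hz]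
              ring)
        rw [← (Fin.snocEquiv (fun _ => Fin q)).sum_comp, Fintype.sum_prod_type] at h1
        rw [← h1]
        apply Finset.sum_congr rfl
        intro b _
        rw [hG, Finset.sum_mul]
        apply Finset.sum_congr rfl
        intro a' _
        simp only [Fin.snocEquiv, Equiv.coe_fn_mk]
        rw [Fin.prod_univ_castSucc]
        simp only [Fin.snoc_castSucc, Fin.snoc_last, Fin.val_castSucc, Fin.val_last,
          Function.update_self]
        rw [mul_assoc]
        congr 2
        apply Finset.prod_congr rfl
        intro j _
        rw [Function.update_of_ne (by have := j.2; omega)]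
      have hp0 : (∑ b : Fin q, C (G b) * X ^ (b : ℕ) : K[X]) = 0 := by
        apply Polynomial.eq_zero_of_natDegree_lt_card_of_eval_eq_zero _
          (f := fun ζ : F => z + algebraMap F K ζ)
        · intro a b hab
          exact (algebraMap F K).injective (add_left_cancel hab)
        · intro ζ
          rw [eval_finsetSum]
          simpa using hev ζ
        · rw [← hq]
          refine lt_of_le_of_lt (natDegree_sum_le_of_forall_le (n := q - 1) _ _ ?_) (by omega)
          intro b _
          refine (natDegree_C_mul_X_pow_le _ _).trans (by omega)
      intro b
      have hc := congrArg (fun p => coeff p (b : ℕ)) hp0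
      simp only [finsetSum_coeff, coeff_C_mul, coeff_X_pow, coeff_zero] at hc
      rw [Finset.sum_eq_single b] at hc
      · simpa using hc
      · intro b' _ hb'
        rw [if_neg (fun h => hb' (Fin.ext h.symm)), mul_zero]
      · simp
    funext a
    have := congrFun (key (a (Fin.last ℓ))) (Fin.init a)
    simpa [Fin.snoc_init_self] using this

lemma sp_exists_root {K : Type} [Field K] [IsAlgClosed K] (q : ℕ) (hq2 : 2 ≤ q) (w : K) :
    ∃ z : K, z ^ q = z - w := by
  have hdeg : (X ^ q - X + C w : K[X]).degree = (q : ℕ) := by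
    rw [sub_add]
    rw [degree_sub_eq_left_of_degree_lt, degree_X_pow]
    rw [degree_X_pow]
    refine lt_of_le_of_lt (degree_sub_le _ _) ?_
    rw [max_lt_iff]
    constructor
    · rw [degree_X]; exact_mod_cast hq2
    · exact lt_of_le_of_lt degree_C_le (by exact_mod_cast (by omega : 0 < q))
  obtain ⟨z, hz⟩ := IsAlgClosed.exists_root (X ^ q - X + C w : K[X])
    (by rw [hdeg]; exact_mod_cast (by omega : q ≠ 0))
  refine ⟨z, ?_⟩
  simp only [IsRoot, eval_add, eval_sub, eval_pow, eval_X, eval_C] at hz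
  linear_combination hz

lemma sp_exists_seq {K : Type} [Field K] [IsAlgClosed K] (q : ℕ) (hq2 : 2 ≤ q) (x : K) :
    ∃ y : ℕ → K, y 0 = 1 ∧ ∀ j, y (j + 1) ^ q = y (j + 1) - x * y j := by
  choose f hf using fun w : K => sp_exists_root q hq2 w
  let y : ℕ → K := fun n => Nat.rec 1 (fun _ z => f (x * z)) n
  exact ⟨y, rfl, fun j => hf (x * y j)⟩

section sp_val

variable {E : Type} [Field E] {Γ : Type} [LinearOrderedCommGroupWithZero Γ] (v : Valuation E Γ)

lemma sp_val_root (q : ℕ) (hq : 2 ≤ q) (z w : E) (hw : 1 < v w) (h : z ^ q = z - w) :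
    1 < v z ∧ v z ^ q = v w := by
  have hw' : w = z - z ^ q := by rw [h]; ring
  have h1 : 1 < v z := by
    by_contra hcon
    push Not at hcon
    have : v w ≤ 1 := by
      rw [hw']
      refine (v.map_sub _ _).trans (max_le hcon ?_)
      rw [map_pow]
      exact pow_le_one₀ zero_le hcon
    exact absurd hw (not_lt.2 this)
  refine ⟨h1, ?_⟩
  rw [hw', Valuation.map_sub_eq_of_lt_right, map_pow]
  rw [map_pow]
  calc v z = v z ^ 1 := (pow_one _).symm
    _ < v z ^ q := pow_lt_pow_right₀ h1 (by omega)

lemma sp_val_y (q ℓ : ℕ) (hq : 2 ≤ q) (x : E) (hx : 1 < v x) (y : ℕ → E) (hy0 : y 0 = 1)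
    (hy : ∀ j, y (j + 1) ^ q = y (j + 1) - x * y j) (j : ℕ) (hj : j ≤ ℓ) :
    1 ≤ v (y j) ∧ v (y j) ^ (q ^ ℓ) = v x ^ spW q ℓ j := by
  induction j with
  | zero => simp [hy0, spW]
  | succ j ih =>
    obtain ⟨h1, h2⟩ := ih (by omega)
    have hw : 1 < v (x * y j) := by
      rw [map_mul]; exact one_lt_mul_of_lt_of_le hx h1
    obtain ⟨h3, h4⟩ := sp_val_root v q hq _ _ hw (hy j)
    refine ⟨h3.le, ?_⟩
    have h5 : (v (y (j + 1)) ^ (q ^ ℓ)) ^ q = (v x ^ spW q ℓ (j + 1)) ^ q := by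
      rw [← pow_mul, mul_comm, pow_mul, h4, map_mul, mul_pow, h2, ← pow_add, ← pow_mul,
        mul_comm (spW q ℓ (j + 1)), spW_succ q ℓ j (by omega)]
    exact (pow_left_inj₀ zero_le zero_le (by omega)).1 h5

lemma sp_val_M (q ℓ : ℕ) (hq : 2 ≤ q) (x : E) (hx : 1 < v x) (y : ℕ → E) (hy0 : y 0 = 1)
    (hy : ∀ j, y (j + 1) ^ q = y (j + 1) - x * y j) (a0 : ℕ) (a : Fin ℓ → ℕ) :
    v (spM x y ℓ a0 a) ^ (q ^ ℓ) = v x ^ spWt q ℓ a0 a := by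
  unfold spM spWt
  rw [map_mul, map_pow, map_prod, mul_pow, pow_add, ← pow_mul, mul_comm a0, ← Finset.prod_pow,
    ← Finset.prod_pow_eq_pow_sum]
  congr 1
  apply Finset.prod_congr rfl
  intro j _
  rw [map_pow, ← pow_mul, mul_comm, pow_mul, (sp_val_y v q ℓ hq x hx y hy0 hy _ j.2).2,
    ← pow_mul, mul_comm]

lemma sp_val_indep {F : Type} [Field F] [Fintype F] [Algebra F E] {ι : Type} (S : Finset ι)
    (t : ι → E) (w : ι → ℕ) (N : ℕ) (hN : 0 < N) (x : E) (hx : 1 < v x)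
    (ht : ∀ i ∈ S, v (t i) ^ N = v x ^ w i) (hw : Set.InjOn w S) (u : ι → F)
    (hu : ∃ i ∈ S, u i ≠ 0) : ∑ i ∈ S, algebraMap F E (u i) * t i ≠ 0 := by
  classical
  have hF : ∀ a : F, a ≠ 0 → v (algebraMap F E a) = 1 := by
    intro a ha
    have h1 : (v (algebraMap F E a)) ^ (Fintype.card F - 1) = 1 := by
      rw [← map_pow, ← map_pow, FiniteField.pow_card_sub_one_eq_one a ha, map_one, map_one]
    have h2 : Fintype.card F - 1 ≠ 0 := by
      have := Fintype.one_lt_card (α := F); omega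
    exact (pow_left_inj₀ zero_le zero_le h2).1 (by rw [h1, one_pow])
  set S' := S.filter (fun i => u i ≠ 0) with hS'
  have hne : S'.Nonempty := by
    obtain ⟨i, hi, hi'⟩ := hu
    exact ⟨i, by rw [hS', Finset.mem_filter]; exact ⟨hi, hi'⟩⟩
  have hsum : ∑ i ∈ S, algebraMap F E (u i) * t i = ∑ i ∈ S', algebraMap F E (u i) * t i := by
    rw [hS', Finset.sum_filter]
    apply Finset.sum_congr rfl
    intro i _
    split_ifs with h
    · rfl
    · push Not at h; simp [h]
  rw [hsum]
  obtain ⟨i0, hi0, hmax⟩ := Finset.exists_max_image S' w hne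
  have hmem : ∀ i ∈ S', i ∈ S ∧ u i ≠ 0 := fun i hi => by simpa [hS'] using hi
  have hlt : ∀ i ∈ S' \ {i0}, v (algebraMap F E (u i) * t i) <
      v (algebraMap F E (u i0) * t i0) := by
    intro i hi
    rw [Finset.mem_sdiff, Finset.mem_singleton] at hi
    rw [map_mul, map_mul, hF _ (hmem i hi.1).2, hF _ (hmem i0 hi0).2, one_mul, one_mul]
    have h1 : w i < w i0 := lt_of_le_of_ne (hmax i hi.1)
      (fun h => hi.2 (hw (hmem i hi.1).1 (hmem i0 hi0).1 h))
    have h2 : v (t i) ^ N < v (t i0) ^ N := by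
      rw [ht i (hmem i hi.1).1, ht i0 (hmem i0 hi0).1]
      exact pow_lt_pow_right₀ hx h1
    exact lt_of_pow_lt_pow_left₀ N zero_le h2
  have hv := v.map_sum_eq_of_lt hi0 hlt
  intro h0
  rw [h0, map_zero, map_mul, hF _ (hmem i0 hi0).2, one_mul] at hv
  have h3 := ht i0 (hmem i0 hi0).1
  rw [← hv, zero_pow (by omega)] at h3
  have : v x ≠ 0 := (zero_lt_one.trans hx).ne'
  exact pow_ne_zero _ this h3.symm

end sp_val

/-- Stepanov's method, in Bombieri's form. -/
theorem sp_stepanov (F : Type) [Field F] [Fintype F] (K : Type) [Field K] [IsAlgClosed K]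
    [Algebra F K] (q : ℕ) (hq : q = Fintype.card F) (ℓ h : ℕ) (c : ℕ → F) (Z : Finset K)
    (hZ : ∀ α ∈ Z, α ^ (q ^ (2 * h)) = α ∧ ∀ y : ℕ → K, y 0 = 1 →
      (∀ j < ℓ, y (j + 1) ^ q = y (j + 1) - α * y j) →
        ∀ j ≤ ℓ, y j ^ (q ^ (2 * h)) = spTau F c y j)
    (hlarge : spG q ℓ * spG q ℓ + 3 * spG q ℓ + 1 < q ^ h) :
    q ^ ℓ * Z.card ≤ q ^ (2 * h) + (2 * spG q ℓ + 1) * q ^ h := by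
  classical
  have hq2 : 2 ≤ q := by rw [hq]; exact Fintype.one_lt_card
  obtain ⟨E, _, _, _, xE, V, hxV⟩ := sp_exists_place F
  set v := V.valuation with hv
  have hxv : 1 < v xE := by
    rw [← not_le, hv, ValuationSubring.valuation_le_one_iff]; exact hxV
  obtain ⟨yE, hyE0, hyE⟩ := sp_exists_seq q hq2 xE
  let Pts := {P : K × (ℕ → K) // P.2 0 = 1 ∧ ∀ j < ℓ, P.2 (j + 1) ^ q = P.2 (j + 1) - P.1 * P.2 j}
  let T := E × (Pts → K)
  let x : T := (xE, fun P => P.1.1)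
  let y : ℕ → T := fun j => (yE j, fun P => P.1.2 j)
  have hy0 : y 0 = 1 := by
    refine Prod.ext hyE0 ?_
    funext P
    exact P.2.1
  have hy : ∀ j < ℓ, y (j + 1) ^ q = y (j + 1) - x * y j := by
    intro j hj
    refine Prod.ext (hyE j) ?_
    funext P
    exact P.2.2 j hj
  -- projections
  let πE : T →ₐ[F] E := AlgHom.fst F E (Pts → K)
  let πP : Pts → (T →ₐ[F] K) := fun P => (Pi.evalAlgHom F (fun _ : Pts => K) P).comp
    (AlgHom.snd F E (Pts → K))
  have hπM : ∀ {K' : Type} [Field K'] [Algebra F K'] (π : T →ₐ[F] K') (z : ℕ → T) (a0 : ℕ)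
      (a : Fin ℓ → ℕ), π (spM x z ℓ a0 a) = spM (π x) (fun j => π (z j)) ℓ a0 a := by
    intro K' _ _ π z a0 a
    simp [spM, map_prod]
  set G := spG q ℓ with hG
  set r := q ^ h with hr
  set A := r - 1 with hA
  set B := r + 2 * G with hB
  have hr1 : 1 ≤ r := by omega
  let mono : ℕ × (Fin ℓ → Fin q) → T := fun a => spM x y ℓ a.1 (fun j => (a.2 j : ℕ))
  let tmono : ℕ × (Fin ℓ → Fin q) → T := fun a => spM x (spTau F c y) ℓ a.1 (fun j => (a.2 j : ℕ))
  let wt : ℕ × (Fin ℓ → Fin q) → ℕ := fun a => spWt q ℓ a.1 (fun j => (a.2 j : ℕ))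
  let SA := spRed q ℓ A
  let SB := spRed q ℓ B
  -- the linear map
  let L := spL F q ℓ x y (r * A + B)
  have hΦmem : ∀ p : SA × SB, mono p.1.1 ^ r * tmono p.2.1 ∈ L := by
    intro p
    have h1 : wt p.1.1 ≤ A := (mem_spRed (by omega) _).1 p.1.2
    have h2 : wt p.2.1 ≤ B := (mem_spRed (by omega) _).1 p.2.2
    refine spL_mono q ℓ x y (Nat.add_le_add (Nat.mul_le_mul_left r h1) h2) ?_
    exact spL_mul q ℓ x y (spL_pow q ℓ x y (spL_M q ℓ x y _ _) r) (spL_tau q ℓ x y hy0 c _ _)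
  let Φ : (SA × SB → F) →ₗ[F] L :=
    Fintype.linearCombination F (fun p : SA × SB => (⟨_, hΦmem p⟩ : L))
  have hLspan := spL_red (F := F) q ℓ hq2 x y hy0 hy
  have hfin : Module.Finite F L := by
    have : L = _ := hLspan (r * A + B)
    rw [this]
    exact Module.Finite.span_of_finite F ((Finset.finite_toSet _).image _)
  have hrank : Module.finrank F L ≤ r * A + B + 1 := by
    have : L = _ := hLspan (r * A + B)
    rw [this, ← Finset.coe_image]
    refine (finrank_span_finset_le_card _).trans ?_
    exact Finset.card_image_le.trans (card_spRed_le (by omega) _)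
  have hker : LinearMap.ker Φ ≠ ⊥ := by
    apply LinearMap.ker_ne_bot_of_finrank_lt
    refine lt_of_le_of_lt hrank ?_
    rw [Module.finrank_fintype_fun_eq_card, Fintype.card_prod, Fintype.card_coe, Fintype.card_coe]
    have h1 : A + 1 ≤ SA.card + G := le_card_spRed (by omega) A
    have h2 : B + 1 ≤ SB.card + G := le_card_spRed (by omega) B
    have h3 : r - G ≤ SA.card := by omega
    have h4 : r + G + 1 ≤ SB.card := by omega
    refine lt_of_lt_of_le ?_ (Nat.mul_le_mul h3 h4)
    have hGr : G ≤ r := by nlinarith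
    obtain ⟨s, hs⟩ : ∃ s, r = G + s := ⟨r - G, by omega⟩
    have hA' : A = G + s - 1 := by omega
    have hAr : r * A + r = r * r := by
      have : A + 1 = r := by omega
      calc r * A + r = r * (A + 1) := by ring
        _ = r * r := by rw [this]
    have h5 : r - G = s := by omega
    rw [h5, hB]
    have h6 : r * A + (r + 2 * G) + 1 = r * r + 2 * G + 1 := by omega
    rw [h6, hs]
    rw [hs] at hlarge
    nlinarith
  obtain ⟨u, hu, hune⟩ := Submodule.exists_mem_ne_zero_of_ne_bot hker
  have hΦu : ∑ p : SA × SB, u p • (mono p.1.1 ^ r * tmono p.2.1) = 0 := by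
    have h1 : Φ u = 0 := hu
    have h2 := congrArg (Submodule.subtype L) h1
    simpa [Φ, Fintype.linearCombination_apply] using h2
  -- the auxiliary function
  let H : T := ∑ p : SA × SB, u p • (mono p.1.1 * mono p.2.1 ^ r)
  have hHL : H ∈ spL F q ℓ x y (A + r * B) := by
    apply Submodule.sum_mem
    intro p _
    apply Submodule.smul_mem
    have h1 : wt p.1.1 ≤ A := (mem_spRed (by omega) _).1 p.1.2
    have h2 : wt p.2.1 ≤ B := (mem_spRed (by omega) _).1 p.2.2
    refine spL_mono q ℓ x y (Nat.add_le_add h1 (Nat.mul_le_mul_left r h2)) ?_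
    exact spL_mul q ℓ x y (spL_M q ℓ x y _ _) (spL_pow q ℓ x y (spL_M q ℓ x y _ _) r)
  have hHE : πE H ≠ 0 := by
    have h1 : πE H = ∑ p : SA × SB, algebraMap F E (u p) * (πE (mono p.1.1) * πE (mono p.2.1) ^ r) := by
      simp only [H, map_sum, map_mul, map_pow, Algebra.smul_def, AlgHom.commutes]
    rw [h1]
    have hvm : ∀ a, v (πE (mono a)) ^ (q ^ ℓ) = v xE ^ wt a := by
      intro a
      have := sp_val_M v q ℓ hq2 xE hxv yE hyE0 hyE a.1 (fun j => (a.2 j : ℕ))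
      rw [hπM πE]
      exact this
    apply sp_val_indep v Finset.univ (fun p : SA × SB => πE (mono p.1.1) * πE (mono p.2.1) ^ r)
      (fun p => wt p.1.1 + r * wt p.2.1) (q ^ ℓ) (by positivity) xE hxv
    · intro p _
      rw [map_mul, map_pow, mul_pow, hvm, ← pow_mul, mul_comm r, pow_mul, hvm, ← pow_mul,
        ← pow_add, mul_comm r]
    · intro p _ p' _ hpp
      have h1 : wt p.1.1 ≤ A := (mem_spRed (by omega) _).1 p.1.2
      have h2 : wt p'.1.1 ≤ A := (mem_spRed (by omega) _).1 p'.1.2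
      have hpp' : wt p.1.1 + r * wt p.2.1 = wt p'.1.1 + r * wt p'.2.1 := hpp
      have h3 : wt p.1.1 = wt p'.1.1 := by
        have := congrArg (· % r) hpp'
        simp only [Nat.add_mul_mod_self_left] at this
        rwa [Nat.mod_eq_of_lt (by omega), Nat.mod_eq_of_lt (by omega)] at this
      have h4 : wt p.2.1 = wt p'.2.1 := by
        rw [h3] at hpp'
        exact Nat.eq_of_mul_eq_mul_left (by omega) (Nat.add_left_cancel hpp')
      exact Prod.ext (Subtype.ext (spWt_inj (by omega) _ _ h3))
        (Subtype.ext (spWt_inj (by omega) _ _ h4))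
    · by_contra hcon
      push Not at hcon
      exact hune (funext fun p => hcon p (Finset.mem_univ _))
  -- vanishing at the points
  obtain ⟨p, hp⟩ := CharP.exists F
  have : Fact p.Prime := ⟨CharP.char_is_prime F p⟩
  have : CharP K p := charP_of_injective_algebraMap (algebraMap F K).injective p
  have : ExpChar K p := ExpChar.prime Fact.out
  obtain ⟨nn, -, hnn⟩ := FiniteField.card F p
  have hqn : q = p ^ (nn : ℕ) := by rw [hq, hnn]
  have hrp : r = p ^ ((nn : ℕ) * h) := by rw [hr, hqn, pow_mul]
  have hur : ∀ a : F, a ^ r = a := by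
    intro a; rw [hr, hq]; exact FiniteField.pow_card_pow h a
  have hrr : r * r = q ^ (2 * h) := by rw [hr, ← pow_add]; congr 1; omega
  have hHP : ∀ P : Pts, P.1.1 ∈ Z → πP P H = 0 := by
    intro P hPZ
    obtain ⟨hα, hαy⟩ := hZ _ hPZ
    have hPy := hαy P.1.2 P.2.1 P.2.2
    have h1 : (πP P H) ^ r = πP P (∑ p : SA × SB, u p • (mono p.1.1 ^ r * tmono p.2.1)) := by
      simp only [H, map_sum, map_mul, map_pow, Algebra.smul_def, AlgHom.commutes]
      rw [hrp, sum_pow_char_pow, ← hrp]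
      apply Finset.sum_congr rfl
      intro p _
      rw [mul_pow, mul_pow, ← map_pow, hur, ← pow_mul, hrr]
      congr 2
      rw [hπM, hπM]
      unfold spM
      rw [mul_pow, ← Finset.prod_pow, ← pow_mul, mul_comm _ (q ^ (2 * h)), pow_mul]
      congr 1
      · congr 1
      · apply Finset.prod_congr rfl
        intro j _
        rw [← pow_mul, mul_comm _ (q ^ (2 * h)), pow_mul]
        congr 1
        have h2 := hPy (j + 1) j.2
        have h3 : (πP P) (spTau F c y (j + 1)) = spTau F c P.1.2 (j + 1) := by
          unfold spTau
          simp only [map_sum, map_mul]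
          apply Finset.sum_congr rfl
          intro i _
          rw [AlgHom.commutes]
          rfl
        exact h2.trans h3.symm
    rw [hΦu, map_zero] at h1
    exact (pow_eq_zero_iff (by omega)).1 h1
  -- expand in reduced monomials
  rw [hLspan, ← Finset.coe_image] at hHL
  obtain ⟨g, hg⟩ : ∃ g : (ℕ × (Fin ℓ → Fin q)) → F,
      ∑ a ∈ spRed q ℓ (A + r * B), g a • mono a = H := by
    rw [Finset.coe_image] at hHL
    obtain ⟨g0, hg0⟩ := (Submodule.mem_span_image_finset_iff_exists_fun F).1 hHL
    refine ⟨fun a => if h : a ∈ spRed q ℓ (A + r * B) then g0 ⟨a, h⟩ else 0, ?_⟩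
    rw [← hg0, ← Finset.sum_coe_sort]
    apply Finset.sum_congr rfl
    intro a _
    beta_reduce
    rw [dif_pos a.2]
  set D := A + r * B with hD
  set g' : ℕ × (Fin ℓ → Fin q) → F := fun a => if a ∈ spRed q ℓ D then g a else 0 with hg'
  have hg2 : ∑ a ∈ (Finset.range (D + 1)) ×ˢ (Finset.univ : Finset (Fin ℓ → Fin q)),
      g' a • mono a = H := by
    rw [← hg]
    symm
    have hsub : spRed q ℓ D ⊆ (Finset.range (D + 1)) ×ˢ (Finset.univ : Finset (Fin ℓ → Fin q)) :=
      Finset.filter_subset _ _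
    rw [← Finset.sum_subset hsub (f := fun a => g' a • mono a)]
    · apply Finset.sum_congr rfl
      intro a ha
      rw [hg']; simp only [if_pos ha]
    · intro a _ ha
      rw [hg']; simp only [if_neg ha, zero_smul]
  let Pol : (Fin ℓ → Fin q) → F[X] := fun a => ∑ n ∈ Finset.range (D + 1), C (g' (n, a)) * X ^ n
  have hPolcoeff : ∀ a n, n < D + 1 → (Pol a).coeff n = g' (n, a) := by
    intro a n hn
    simp only [Pol, finsetSum_coeff, coeff_C_mul, coeff_X_pow]
    rw [Finset.sum_eq_single n]
    · simp
    · intro b _ hb; rw [if_neg (Ne.symm hb), mul_zero]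
    · intro hb; exact absurd (Finset.mem_range.2 hn) hb
  obtain ⟨a, ha⟩ : ∃ a, Pol a ≠ 0 := by
    by_contra hcon
    push Not at hcon
    apply hHE
    rw [← hg2]
    rw [Finset.sum_eq_zero, map_zero]
    rintro ⟨n, a⟩ hna
    rw [Finset.mem_product, Finset.mem_range] at hna
    rw [← hPolcoeff a n hna.1, hcon a, coeff_zero, zero_smul]
  have hroot : ∀ α ∈ Z, aeval α (Pol a) = 0 := by
    intro α hα
    have hfz := sp_fibre (F := F) q hq α ℓ (fun a => aeval α (Pol a)) (by
      intro z hz0 hz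
      have h1 := hHP ⟨(α, z), hz0, hz⟩ hα
      rw [← hg2, map_sum, Finset.sum_product_right] at h1
      rw [← h1]
      apply Finset.sum_congr rfl
      intro a _
      simp only [Pol, map_sum, map_mul, map_pow, aeval_C, aeval_X, Finset.sum_mul,
        Algebra.smul_def, AlgHom.commutes]
      apply Finset.sum_congr rfl
      intro n _
      rw [hπM]
      unfold spM
      rw [mul_assoc]
      rfl)
    exact congrFun hfz a
  have hcard : Z.card ≤ (Pol a).natDegree := by
    have h1 : Z.val ⊆ ((Pol a).map (algebraMap F K)).roots := by
      intro α hα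
      rw [mem_roots_map ha]
      exact hroot α hα
    have h2 : Z.card ≤ ((Pol a).map (algebraMap F K)).roots.card :=
      Multiset.card_le_card ((Multiset.le_iff_subset Z.nodup).2 h1)
    exact h2.trans ((card_roots' _).trans natDegree_map_le)
  have hdeg : q ^ ℓ * (Pol a).natDegree ≤ D := by
    have h1 : (Pol a).natDegree < D + 1 := by
      refine lt_of_le_of_lt (natDegree_sum_le_of_forall_le (n := D) _ _ ?_) (by omega)
      intro n hn
      rw [Finset.mem_range] at hn
      exact (natDegree_C_mul_X_pow_le _ _).trans (by omega)
    have h2 : (Pol a).coeff (Pol a).natDegree ≠ 0 := by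
      rw [coeff_natDegree]; exact leadingCoeff_ne_zero.2 ha
    rw [hPolcoeff a _ h1] at h2
    have h3 : ((Pol a).natDegree, a) ∈ spRed q ℓ D := by
      by_contra hcon
      apply h2
      rw [hg']; simp only [if_neg hcon]
    have h4 := (mem_spRed (by omega) _).1 h3
    unfold spWt at h4
    simp only at h4
    omega
  calc q ^ ℓ * Z.card ≤ q ^ ℓ * (Pol a).natDegree := Nat.mul_le_mul_left _ hcard
    _ ≤ D := hdeg
    _ ≤ q ^ (2 * h) + (2 * G + 1) * r := by
      rw [← hrr, hD, hB, mul_add]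
      have : r * (2 * G) + r = (2 * G + 1) * r := by ring
      omega

section sp_frob

variable (F : Type) [Field F] [Fintype F] {K : Type} [Field K] [Algebra F K]

lemma sp_pow_sub (k : ℕ) (a b : K) :
    (a - b) ^ (Fintype.card F ^ k) = a ^ (Fintype.card F ^ k) - b ^ (Fintype.card F ^ k) := by
  obtain ⟨p, hp⟩ := CharP.exists F
  have : Fact p.Prime := ⟨CharP.char_is_prime F p⟩
  have : CharP K p := charP_of_injective_algebraMap (algebraMap F K).injective p
  have : ExpChar K p := ExpChar.prime Fact.out
  obtain ⟨nn, -, hnn⟩ := FiniteField.card F p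
  rw [hnn, ← pow_mul]
  exact sub_pow_expChar_pow a b _

lemma sp_pow_inj (k : ℕ) (a b : K) (h : a ^ (Fintype.card F ^ k) = b ^ (Fintype.card F ^ k)) :
    a = b := by
  have h1 := sp_pow_sub F k a b
  rw [h, sub_self] at h1
  exact sub_eq_zero.1 (pow_eq_zero_iff (pow_ne_zero _ Fintype.card_ne_zero) |>.1 h1)

lemma sp_root_dvd (P : F[X]) (hP : Irreducible P) (α : K) (hα : aeval α P = 0) (n : ℕ) :
    P.natDegree ∣ n ↔ α ^ (Fintype.card F ^ n) = α := by
  rw [hP.natDegree_dvd_iff_dvd_X_pow_card_pow_sub_X, Nat.card_eq_fintype_card]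
  constructor
  · rintro ⟨g, hg⟩
    have := congrArg (aeval α) hg
    simp only [map_sub, map_pow, aeval_X, map_mul, hα, zero_mul] at this
    exact sub_eq_zero.1 this
  · intro h
    have h1 : minpoly F α ∣ X ^ (Fintype.card F ^ n) - X := by
      apply minpoly.dvd
      simp [h]
    refine dvd_trans ?_ h1
    have h2 := minpoly.dvd F α hα
    have hintF : IsIntegral F α := (isAlgebraic_iff_isIntegral).1 ⟨P, hP.ne_zero, hα⟩
    exact ((minpoly.irreducible hintF).associated_of_dvd hP h2).symm.dvd

lemma sp_factor [IsAlgClosed K] (P : F[X]) (hP : Irreducible P) (hm : P.Monic) (α : K)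
    (hα : aeval α P = 0) :
    P.map (algebraMap F K) =
      ∏ i ∈ Finset.range P.natDegree, (X - C (α ^ (Fintype.card F ^ i))) := by
  classical
  set d := P.natDegree with hd
  have hsplit : (P.map (algebraMap F K)).Splits := IsAlgClosed.splits _
  have hmm : (P.map (algebraMap F K)).Monic := hm.map _
  have hroot : ∀ i, aeval (α ^ (Fintype.card F ^ i)) P = 0 := by
    intro i
    induction i with
    | zero => simpa using hα
    | succ i ih =>
      have h1 := congrArg (aeval (α ^ (Fintype.card F ^ i))) (FiniteField.expand_card P)
      rw [expand_aeval, map_pow, ih, zero_pow Fintype.card_ne_zero, ← pow_mul, ← pow_succ] at h1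
      exact h1
  have hinj : Set.InjOn (fun i => α ^ (Fintype.card F ^ i)) (Finset.range d : Set ℕ) := by
    have key : ∀ i j, i < j → j < d → α ^ (Fintype.card F ^ i) ≠ α ^ (Fintype.card F ^ j) := by
      intro i j hij hj h
      have h1 : α = α ^ (Fintype.card F ^ (j - i)) := by
        apply sp_pow_inj F i
        rw [h, ← pow_mul, ← pow_add]
        congr 2; omega
      have h2 := (sp_root_dvd F P hP α hα (j - i)).2 h1.symm
      have := Nat.le_of_dvd (by omega) h2
      omega
    intro i hi j hj h
    simp only [Finset.coe_range, Set.mem_Iio] at hi hj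
    rcases lt_trichotomy i j with h' | h' | h'
    · exact absurd h (key i j h' hj)
    · exact h'
    · exact absurd h.symm (key j i h' hi)
  have hroots : (P.map (algebraMap F K)).roots =
      ((Finset.range d).image (fun i => α ^ (Fintype.card F ^ i))).val := by
    symm
    apply Multiset.eq_of_le_of_card_le
    · rw [Multiset.le_iff_subset (Finset.nodup _)]
      intro β hβ
      rw [Finset.mem_val, Finset.mem_image] at hβ
      obtain ⟨i, -, rfl⟩ := hβ
      rw [mem_roots_map hP.ne_zero]
      exact hroot i
    · rw [Finset.card_val, Finset.card_image_of_injOn hinj, Finset.card_range]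
      exact (card_roots' _).trans natDegree_map_le
  rw [hsplit.eq_prod_roots_of_monic hmm, hroots]
  rw [← Finset.prod_image (f := fun β => (X - C β : K[X])) hinj]
  rfl

end sp_frob

lemma sp_reverse_map {F K : Type} [Field F] [Field K] (f : F →+* K) (P : F[X]) :
    (P.map f).reverse = P.reverse.map f := by
  ext n
  rw [coeff_map, coeff_reverse, coeff_reverse, coeff_map, natDegree_map]

lemma sp_reverse_prod {K : Type} [Field K] (s : Finset ℕ) (f : ℕ → K[X]) :
    (∏ i ∈ s, f i).reverse = ∏ i ∈ s, (f i).reverse := by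
  classical
  induction s using Finset.induction_on with
  | empty => rw [Finset.prod_empty, Finset.prod_empty, ← C_1, reverse_C]
  | insert a s ha ih => rw [Finset.prod_insert ha, Finset.prod_insert ha, reverse_mul_of_domain, ih]

lemma sp_reverse_X_sub_C {K : Type} [Field K] (a : K) : (X - C a : K[X]).reverse = 1 - C a * X := by
  rw [reverse, natDegree_X_sub_C, reflect_sub, reflect_C]
  have : reflect 1 (X : K[X]) = 1 := by
    have := reflect_monomial (R := K) 1 1
    simpa using this
  rw [this, pow_one]

lemma sp_y_pow {F : Type} [Field F] [Fintype F] {K : Type} [Field K] [Algebra F K] (α : K) (ℓ : ℕ)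
    (y : ℕ → K) (hy0 : y 0 = 1) (hy : ∀ j < ℓ, y (j + 1) ^ (Fintype.card F) = y (j + 1) - α * y j)
    (k j : ℕ) (hj : j ≤ ℓ) :
    y j ^ (Fintype.card F ^ k) = PowerSeries.coeff j (PowerSeries.mk y *
      ((∏ i ∈ Finset.range k, (1 - C (α ^ (Fintype.card F ^ i)) * X) : K[X]) : PowerSeries K)) := by
  induction k generalizing j with
  | zero => simp
  | succ k ih =>
    rw [Finset.prod_range_succ, Polynomial.coe_mul, ← mul_assoc]
    set Q := PowerSeries.mk y *
      ((∏ i ∈ Finset.range k, (1 - C (α ^ (Fintype.card F ^ i)) * X) : K[X]) : PowerSeries K) with hQ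
    have h1 : (((1 - C (α ^ (Fintype.card F ^ k)) * X) : K[X]) : PowerSeries K) =
        1 - PowerSeries.C (α ^ (Fintype.card F ^ k)) * PowerSeries.X := by
      rw [Polynomial.coe_sub, Polynomial.coe_one, Polynomial.coe_mul, Polynomial.coe_C,
        Polynomial.coe_X]
    rw [h1, mul_sub, mul_one, map_sub, mul_left_comm, PowerSeries.coeff_C_mul]
    cases j with
    | zero =>
      rw [← ih 0 hj, PowerSeries.coeff_zero_mul_X, hy0]; simp
    | succ j =>
      rw [PowerSeries.coeff_succ_mul_X, ← ih _ hj, ← ih j (by omega), pow_succ', pow_mul, hy j (by omega),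
        sp_pow_sub F, mul_pow]

theorem sp_count (F : Type) [Field F] [Fintype F] (q : ℕ) (hq : q = Fintype.card F) (ℓ h : ℕ)
    (hh : 0 < h) (c : ℕ → F) (T : Finset F[X])
    (hT : ∀ P ∈ T, P.Monic ∧ Irreducible P ∧ P.natDegree ∣ 2 * h ∧
      ∀ j ≤ ℓ, (P.reverse ^ (2 * h / P.natDegree)).coeff j = c j)
    (hlarge : spG q ℓ * spG q ℓ + 3 * spG q ℓ + 1 < q ^ h) :
    q ^ ℓ * ∑ P ∈ T, P.natDegree ≤ q ^ (2 * h) + (2 * spG q ℓ + 1) * q ^ h := by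
  classical
  let K := AlgebraicClosure F
  let Z : Finset K := T.biUnion (fun P => (P.map (algebraMap F K)).roots.toFinset)
  have hmem : ∀ P ∈ T, ∀ α : K, α ∈ (P.map (algebraMap F K)).roots.toFinset ↔ aeval α P = 0 := by
    intro P hP α
    rw [Multiset.mem_toFinset, mem_roots_map (hT P hP).1.ne_zero]
    rfl
  have hcard : Z.card = ∑ P ∈ T, P.natDegree := by
    rw [Finset.card_biUnion]
    · apply Finset.sum_congr rfl
      intro P hP
      obtain ⟨hm, hi, -⟩ := hT P hP
      rw [Multiset.toFinset_card_of_nodup]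
      · have h1 : (P.map (algebraMap F K)).Splits := IsAlgClosed.splits _
        rw [← h1.natDegree_eq_card_roots, natDegree_map]
      · apply nodup_roots
        exact (PerfectField.separable_of_irreducible hi).map
    · intro P hP P' hP' hne
      change Disjoint (P.map (algebraMap F K)).roots.toFinset (P'.map (algebraMap F K)).roots.toFinset
      rw [Finset.disjoint_left]
      intro α h1 h2
      rw [hmem P hP] at h1
      rw [hmem P' hP'] at h2
      apply hne
      rw [minpoly.eq_of_irreducible_of_monic (hT P hP).2.1 h1 (hT P hP).1,
        minpoly.eq_of_irreducible_of_monic (hT P' hP').2.1 h2 (hT P' hP').1]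
  rw [← hcard]
  apply sp_stepanov F K q hq ℓ h c Z _ hlarge
  intro α hα
  rw [Finset.mem_biUnion] at hα
  obtain ⟨P, hP, hα⟩ := hα
  rw [hmem P hP] at hα
  obtain ⟨hm, hi, hd, hc⟩ := hT P hP
  have hper := (sp_root_dvd F P hi α hα P.natDegree).1 dvd_rfl
  refine ⟨by rw [hq]; exact (sp_root_dvd F P hi α hα _).1 hd, ?_⟩
  intro y hy0 hy j hj
  rw [hq] at hy ⊢
  rw [sp_y_pow α ℓ y hy0 hy (2 * h) j hj]
  have hN : (∏ i ∈ Finset.range (2 * h), (1 - C (α ^ (Fintype.card F ^ i)) * X) : K[X]) =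
      (P.reverse ^ (2 * h / P.natDegree)).map (algebraMap F K) := by
    obtain ⟨e, he⟩ := hd
    have hd0 : 0 < P.natDegree := hi.natDegree_pos
    rw [he, Nat.mul_div_cancel_left _ hd0, Polynomial.map_pow, ← sp_reverse_map,
      sp_factor F P hi hm α hα, sp_reverse_prod]
    simp only [sp_reverse_X_sub_C]
    clear he
    induction e with
    | zero => simp
    | succ e ih =>
      rw [mul_add, mul_one, Finset.prod_range_add, ih, pow_succ]
      congr 1
      apply Finset.prod_congr rfl
      intro i _
      have h1 : α ^ (Fintype.card F ^ (P.natDegree * e)) = α :=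
        (sp_root_dvd F P hi α hα _).1 (dvd_mul_right _ _)
      rw [pow_add, pow_mul, h1]
  rw [hN, mul_comm, PowerSeries.coeff_mul]
  rw [Finset.Nat.sum_antidiagonal_eq_sum_range_succ_mk]
  unfold spTau
  apply Finset.sum_congr rfl
  intro i hi'
  rw [Finset.mem_range] at hi'
  simp only [PowerSeries.coeff_mk, Polynomial.coeff_coe, coeff_map]
  rw [hc i (by omega)]

section sp_monics

variable (F : Type) [Field F] [Fintype F]

/-- Equivalence between monic polynomials of degree `k` and coefficient tuples. -/
noncomputable def spMonEquiv (k : ℕ) : {f : F[X] // f.Monic ∧ f.natDegree = k} ≃ (Fin k → F) :=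
  (monicEquivDegreeLT k).trans (degreeLTEquiv F k).toEquiv

lemma spMon_finite (k : ℕ) : {f : F[X] | f.Monic ∧ f.natDegree = k}.Finite :=
  have : Finite {f : F[X] // f.Monic ∧ f.natDegree = k} := Finite.of_equiv _ (spMonEquiv F k).symm
  @Set.toFinite _ {f : F[X] | f.Monic ∧ f.natDegree = k} this

/-- Monic polynomials of degree `k`. -/
noncomputable def spMon (k : ℕ) : Finset F[X] := (spMon_finite F k).toFinset

variable {F} in
lemma mem_spMon {k : ℕ} {f : F[X]} : f ∈ spMon F k ↔ f.Monic ∧ f.natDegree = k := by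
  simp [spMon]

lemma card_spMon (k : ℕ) : (spMon F k).card = Fintype.card F ^ k := by
  classical
  rw [spMon, ← Set.ncard_eq_toFinset_card _ (spMon_finite F k), ← Nat.card_coe_set_eq]
  have := Nat.card_congr (spMonEquiv F k)
  rw [Nat.card_fun, Nat.card_fin, Nat.card_eq_fintype_card (α := F)] at this
  exact this

open Classical in
/-- Monic irreducible polynomials of degree `d`. -/
noncomputable def spIrr (d : ℕ) : Finset F[X] := (spMon F d).filter (fun P => Irreducible P)

open Classical in
/-- Monic `m`-smooth polynomials of degree `n`. -/
noncomputable def spSm (n m : ℕ) : Finset F[X] :=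
  (spMon F n).filter (fun f => ∀ w : F[X], Irreducible w → w ∣ f → w.natDegree ≤ m)

variable {F}

lemma mem_spIrr {d : ℕ} {P : F[X]} : P ∈ spIrr F d ↔ P.Monic ∧ P.natDegree = d ∧ Irreducible P := by
  simp [spIrr, mem_spMon, and_assoc]

lemma mem_spSm {n m : ℕ} {f : F[X]} : f ∈ spSm F n m ↔ f.Monic ∧ f.natDegree = n ∧
    ∀ w : F[X], Irreducible w → w ∣ f → w.natDegree ≤ m := by
  simp [spSm, mem_spMon, and_assoc]

lemma spSm_of_le {n m : ℕ} (h : n ≤ m) : spSm F n m = spMon F n := by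
  ext f
  rw [mem_spSm, mem_spMon]
  constructor
  · rintro ⟨h1, h2, -⟩; exact ⟨h1, h2⟩
  · rintro ⟨h1, h2⟩
    refine ⟨h1, h2, fun w _ hw => ?_⟩
    exact (natDegree_le_of_dvd hw h1.ne_zero).trans (by omega)

lemma spMon_zero : spMon F 0 = {1} := by
  ext f
  rw [mem_spMon, Finset.mem_singleton]
  constructor
  · rintro ⟨h1, h2⟩; exact h1.natDegree_eq_zero.1 h2
  · rintro rfl; exact ⟨monic_one, natDegree_one⟩

open Classical in
lemma sp_degree_identity (f : F[X]) (hf : f.Monic) (N : ℕ) (hN : f.natDegree ≤ N) :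
    f.natDegree = ∑ d ∈ Finset.Icc 1 N, ∑ P ∈ spIrr F d, ∑ e ∈ Finset.Icc 1 N,
      if P ^ e ∣ f then d else 0 := by
  have hf0 := hf.ne_zero
  set nf := UniqueFactorizationMonoid.normalizedFactors f with hnf
  have hirr : ∀ P ∈ nf, Irreducible P := fun P hP =>
    UniqueFactorizationMonoid.irreducible_of_normalized_factor P hP
  have hmon : ∀ P ∈ nf, P.Monic := fun P hP => by
    rw [← UniqueFactorizationMonoid.normalize_normalized_factor P hP]
    exact monic_normalize (hirr P hP).ne_zero
  have hprod : nf.prod = f := by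
    have := UniqueFactorizationMonoid.prod_normalizedFactors_eq hf0
    rw [hf.normalize_eq_self] at this
    exact this
  have hdeg : f.natDegree = ∑ P ∈ nf.toFinset, nf.count P * P.natDegree := by
    conv_lhs => rw [← hprod]
    rw [natDegree_multiset_prod_of_monic _ hmon, Finset.sum_multiset_map_count]
    simp
  have hle : ∀ P ∈ nf, P.natDegree ≤ N ∧ nf.count P ≤ N ∧ 1 ≤ P.natDegree := by
    intro P hP
    have h1 : nf.count P * P.natDegree ≤ f.natDegree := by
      rw [hdeg]
      exact Finset.single_le_sum (f := fun P => nf.count P * P.natDegree) (fun _ _ => Nat.zero_le _)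
        (Multiset.mem_toFinset.2 hP)
    have h2 : 1 ≤ nf.count P := Multiset.one_le_count_iff_mem.2 hP
    have h3 : 1 ≤ P.natDegree := (hirr P hP).natDegree_pos
    exact ⟨by nlinarith, by nlinarith, h3⟩
  have hcount : ∀ P : F[X], P.Monic → Irreducible P → ∀ e, P ^ e ∣ f ↔ e ≤ nf.count P := by
    intro P hPm hP e
    rw [pow_dvd_iff_le_emultiplicity,
      UniqueFactorizationMonoid.le_emultiplicity_iff_replicate_le_normalizedFactors hP hf0,
      hPm.normalize_eq_self, Multiset.le_count_iff_replicate_le]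
  have hinner : ∀ d, ∀ P ∈ spIrr F d, (∑ e ∈ Finset.Icc 1 N, if P ^ e ∣ f then d else 0) =
      nf.count P * d := by
    intro d P hP
    rw [mem_spIrr] at hP
    rw [← Finset.sum_filter, Finset.sum_const, smul_eq_mul]
    congr 1
    have : (Finset.Icc 1 N).filter (fun e => P ^ e ∣ f) = Finset.Icc 1 (nf.count P) := by
      ext e
      rw [Finset.mem_filter, Finset.mem_Icc, Finset.mem_Icc, hcount P hP.1 hP.2.2]
      have : nf.count P ≤ N := by
        by_cases h : P ∈ nf
        · exact (hle P h).2.1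
        · rw [Multiset.count_eq_zero_of_notMem h]; omega
      omega
    rw [this]; simp
  rw [hdeg]
  rw [← Finset.sum_fiberwise_of_maps_to (s := nf.toFinset) (t := Finset.Icc 1 N)
    (g := fun P => P.natDegree)]
  · apply Finset.sum_congr rfl
    intro d _
    rw [Finset.sum_congr rfl (hinner d)]
    refine (Finset.sum_congr rfl (g := fun P => nf.count P * d) ?_).trans
      (Finset.sum_subset ?_ ?_)
    · intro P hP
      rw [Finset.mem_filter] at hP
      rw [hP.2]
    · intro P hP
      rw [Finset.mem_filter, Multiset.mem_toFinset] at hP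
      exact mem_spIrr.2 ⟨hmon P hP.1, hP.2, hirr P hP.1⟩
    · intro P hP hP'
      rw [Finset.mem_filter, Multiset.mem_toFinset] at hP'
      have : P ∉ nf := fun h => hP' ⟨h, (mem_spIrr.1 hP).2.1⟩
      rw [Multiset.count_eq_zero_of_notMem this, zero_mul]
  · intro P hP
    have := hle P (Multiset.mem_toFinset.1 hP)
    exact Finset.mem_Icc.2 ⟨this.2.2, this.1⟩

/-- Sum of a weight over smooth polynomials. -/
noncomputable def spS (w : F[X] → ℂ) (m n : ℕ) : ℂ := ∑ f ∈ spSm F n m, w f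

/-- Weighted prime power sums. -/
noncomputable def spLam (w : F[X] → ℂ) (m j : ℕ) : ℂ :=
  ∑ p ∈ (Nat.divisorsAntidiagonal j).filter (fun p => p.1 ≤ m),
    (p.1 : ℂ) * ∑ P ∈ spIrr F p.1, w P ^ p.2

open Classical in
lemma sp_smooth_sub (w : F[X] → ℂ) (h1 : w 1 = 1)
    (hmul : ∀ f g : F[X], f.Monic → g.Monic → w (f * g) = w f * w g) (m n d e : ℕ) (P : F[X])
    (hP : P ∈ spIrr F d) (he : 1 ≤ e) :
    (∑ f ∈ (spSm F n m).filter (fun f => P ^ e ∣ f), w f) =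
      if d * e ≤ n ∧ d ≤ m then w P ^ e * spS w m (n - d * e) else 0 := by
  classical
  rw [mem_spIrr] at hP
  obtain ⟨hPm, hPd, hPi⟩ := hP
  have hwpow : ∀ e, w (P ^ e) = w P ^ e := by
    intro e
    induction e with
    | zero => simp [h1]
    | succ e ih => rw [pow_succ, hmul _ _ (hPm.pow e) hPm, ih, pow_succ]
  have hPe : (P ^ e).Monic := hPm.pow e
  have hPed : (P ^ e).natDegree = d * e := by rw [natDegree_pow, hPd, mul_comm]
  split_ifs with hc
  · rw [spS, Finset.mul_sum]
    symm
    apply Finset.sum_bij (fun g _ => P ^ e * g)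
    · intro g hg
      rw [mem_spSm] at hg
      rw [Finset.mem_filter, mem_spSm]
      refine ⟨⟨hPe.mul hg.1, ?_, ?_⟩, dvd_mul_right _ _⟩
      · rw [hPe.natDegree_mul hg.1, hPed, hg.2.1]; omega
      · intro v hv hvd
        rcases hv.prime.dvd_or_dvd hvd with h | h
        · have h2 := natDegree_le_of_dvd (hv.prime.dvd_of_dvd_pow h) hPi.ne_zero
          omega
        · exact hg.2.2 v hv h
    · intro g _ g' _ h
      exact mul_left_cancel₀ hPe.ne_zero h
    · intro f hf
      rw [Finset.mem_filter, mem_spSm] at hf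
      obtain ⟨⟨hfm, hfd, hfs⟩, g, rfl⟩ := hf
      have hg : g.Monic := hPe.of_mul_monic_left hfm
      refine ⟨g, ?_, rfl⟩
      rw [mem_spSm]
      refine ⟨hg, ?_, fun v hv hvd => hfs v hv (hvd.mul_left _)⟩
      rw [hPe.natDegree_mul hg, hPed] at hfd
      omega
    · intro g hg
      rw [mem_spSm] at hg
      rw [hmul _ _ hPe hg.1, hwpow]
  · rw [Finset.filter_false_of_mem, Finset.sum_empty]
    intro f hf hdvd
    rw [mem_spSm] at hf
    apply hc
    constructor
    · rw [← hPed, ← hf.2.1]; exact natDegree_le_of_dvd hdvd hf.1.ne_zero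
    · rw [← hPd]; exact hf.2.2 P hPi ((dvd_pow_self P (by omega)).trans hdvd)

theorem sp_identity (w : F[X] → ℂ) (h1 : w 1 = 1)
    (hmul : ∀ f g : F[X], f.Monic → g.Monic → w (f * g) = w f * w g) (m n : ℕ) :
    (n : ℂ) * spS w m n = ∑ j ∈ Finset.Icc 1 n, spLam w m j * spS w m (n - j) := by
  classical
  have step1 : (n : ℂ) * spS w m n = ∑ d ∈ Finset.Icc 1 n, ∑ e ∈ Finset.Icc 1 n,
      if d * e ≤ n ∧ d ≤ m then (d : ℂ) * (∑ P ∈ spIrr F d, w P ^ e) * spS w m (n - d * e) else 0 := by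
    have h2 : (n : ℂ) * spS w m n = ∑ f ∈ spSm F n m, ∑ d ∈ Finset.Icc 1 n, ∑ P ∈ spIrr F d,
        ∑ e ∈ Finset.Icc 1 n, if P ^ e ∣ f then (d : ℂ) * w f else 0 := by
      rw [spS, Finset.mul_sum]
      apply Finset.sum_congr rfl
      intro f hf
      rw [mem_spSm] at hf
      have h3 := sp_degree_identity f hf.1 n hf.2.1.le
      rw [hf.2.1] at h3
      conv_lhs => rw [h3]
      push_cast
      simp only [Finset.sum_mul, ite_mul, zero_mul]
    rw [h2, Finset.sum_comm]
    apply Finset.sum_congr rfl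
    intro d _
    rw [Finset.sum_comm]
    have h4 : ∀ P ∈ spIrr F d, (∑ f ∈ spSm F n m, ∑ e ∈ Finset.Icc 1 n,
        if P ^ e ∣ f then (d : ℂ) * w f else 0) = ∑ e ∈ Finset.Icc 1 n,
          if d * e ≤ n ∧ d ≤ m then (d : ℂ) * (w P ^ e * spS w m (n - d * e)) else 0 := by
      intro P hP
      rw [Finset.sum_comm]
      apply Finset.sum_congr rfl
      intro e he
      rw [← Finset.sum_filter, ← Finset.mul_sum,
        sp_smooth_sub w h1 hmul m n d e P hP (Finset.mem_Icc.1 he).1, mul_ite, mul_zero]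
    rw [Finset.sum_congr rfl h4, Finset.sum_comm]
    apply Finset.sum_congr rfl
    intro e _
    split_ifs with hc
    · rw [Finset.mul_sum, Finset.sum_mul]
      apply Finset.sum_congr rfl
      intro P _
      ring
    · simp
  rw [step1]
  let Fn : ℕ × ℕ → ℂ := fun p => (p.1 : ℂ) * (∑ P ∈ spIrr F p.1, w P ^ p.2) * spS w m (n - p.1 * p.2)
  have step2 : ∀ j ∈ Finset.Icc 1 n, spLam w m j * spS w m (n - j) =
      ∑ p ∈ Finset.Icc 1 n ×ˢ Finset.Icc 1 n, if p.1 * p.2 = j then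
        (if p.1 ≤ m then Fn p else 0) else 0 := by
    intro j hj
    rw [Finset.mem_Icc] at hj
    rw [spLam, Finset.sum_mul, ← Finset.sum_filter, Finset.sum_filter]
    have : (Finset.Icc 1 n ×ˢ Finset.Icc 1 n).filter (fun p => p.1 * p.2 = j) =
        Nat.divisorsAntidiagonal j := by
      ext ⟨a, b⟩
      simp only [Finset.mem_filter, Finset.mem_product, Finset.mem_Icc,
        Nat.mem_divisorsAntidiagonal]
      constructor
      · rintro ⟨-, h⟩; exact ⟨h, by omega⟩
      · rintro ⟨h, -⟩
        have ha : 1 ≤ a := by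
          rcases Nat.eq_zero_or_pos a with h0 | h0
          · rw [h0] at h; omega
          · exact h0
        have hb : 1 ≤ b := by
          rcases Nat.eq_zero_or_pos b with h0 | h0
          · rw [h0] at h; omega
          · exact h0
        exact ⟨⟨⟨ha, by nlinarith⟩, hb, by nlinarith⟩, h⟩
    rw [this]
    apply Finset.sum_congr rfl
    intro p hp
    rw [Nat.mem_divisorsAntidiagonal] at hp
    simp only [Fn, hp.1]
  rw [Finset.sum_congr rfl step2, Finset.sum_comm (s := Finset.Icc 1 n) (t := Finset.Icc 1 n ×ˢ Finset.Icc 1 n), ← Finset.sum_product']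
  apply Finset.sum_congr rfl
  rintro ⟨d, e⟩ hp
  rw [Finset.mem_product, Finset.mem_Icc, Finset.mem_Icc] at hp
  rw [Finset.sum_ite_eq]
  simp only [Finset.mem_Icc, Fn]
  have : 1 ≤ d * e := Nat.one_le_iff_ne_zero.2 (Nat.mul_ne_zero (by omega) (by omega))
  by_cases h1 : d * e ≤ n <;> by_cases h2 : d ≤ m <;> simp [h1, h2, this]

lemma spLam_of_le (w : F[X] → ℂ) {m j : ℕ} (h : j ≤ m) : spLam w m j = spLam w j j := by
  unfold spLam
  congr 1
  ext p
  simp only [Finset.mem_filter, Nat.mem_divisorsAntidiagonal, and_congr_right_iff]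
  rintro ⟨h1, h2⟩
  have : p.1 ≤ j := Nat.le_of_dvd (by omega) ⟨p.2, h1.symm⟩
  omega

lemma spS_zero (w : F[X] → ℂ) (h1 : w 1 = 1) (m : ℕ) : spS w m 0 = 1 := by
  rw [spS, spSm_of_le (Nat.zero_le m), spMon_zero, Finset.sum_singleton, h1]

lemma spLam_one (j : ℕ) (hj : 1 ≤ j) :
    spLam (fun _ : F[X] => (1 : ℂ)) j j = (Fintype.card F : ℂ) ^ j := by
  induction j using Nat.strong_induction_on with
  | _ n ih =>
    have h := sp_identity (fun _ : F[X] => (1 : ℂ)) rfl (by intros; simp) n n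
    have hs : ∀ k ≤ n, spS (fun _ : F[X] => (1 : ℂ)) n k = (Fintype.card F : ℂ) ^ k := by
      intro k hk
      rw [spS, spSm_of_le hk, Finset.sum_const, card_spMon]; simp
    rw [hs n le_rfl, ← Finset.sum_Ico_add_eq_sum_Icc hj, Nat.sub_self,
      spS_zero _ rfl, mul_one] at h
    have h2 : ∀ j ∈ Finset.Ico 1 n, spLam (fun _ : F[X] => (1 : ℂ)) n j *
        spS (fun _ : F[X] => (1 : ℂ)) n (n - j) = (Fintype.card F : ℂ) ^ n := by
      intro j hj
      rw [Finset.mem_Ico] at hj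
      rw [spLam_of_le _ hj.2.le, ih j hj.2 hj.1, hs _ (Nat.sub_le _ _), ← pow_add]
      congr 1; omega
    rw [Finset.sum_congr rfl h2, Finset.sum_const, Nat.card_Ico, nsmul_eq_mul, Nat.cast_sub hj] at h
    push_cast at h
    linear_combination -h

end sp_monics

lemma sp_reverse_coeff {F : Type} [Field F] (f : F[X]) (i : ℕ) (hi : i ≤ f.natDegree) :
    f.reverse.coeff i = f.coeff (f.natDegree - i) := by
  rw [coeff_reverse, revAt_le hi]

/-- prescribing leading coefficients -/
lemma sp_exists_monic {F : Type} [Field F] (n ℓ : ℕ) (h : ℓ ≤ n) (a : ℕ → F) :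
    ∃ f : F[X], f.Monic ∧ f.natDegree = n ∧ ∀ i, 1 ≤ i → i ≤ ℓ → f.coeff (n - i) = a i := by
  set g : F[X] := ∑ k ∈ Finset.range n, C (a (n - k)) * X ^ k with hg
  have hgd : g.degree < n := by
    refine lt_of_le_of_lt (degree_sum_le _ _) ?_
    rw [Finset.sup_lt_iff (by exact WithBot.bot_lt_coe n)]
    intro k hk
    rw [Finset.mem_range] at hk
    exact lt_of_le_of_lt (degree_C_mul_X_pow_le _ _) (by exact_mod_cast hk)
  have hm : (X ^ n + g).Monic := monic_X_pow_add hgd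
  have hnd : (X ^ n + g).natDegree = n := by
    rw [natDegree_eq_of_degree_eq_some]
    rw [degree_add_eq_left_of_degree_lt] <;> rw [degree_X_pow]
    exact hgd
  refine ⟨X ^ n + g, hm, hnd, ?_⟩
  intro i h1 h2
  rw [coeff_add, coeff_X_pow, if_neg (by omega), zero_add, hg, finsetSum_coeff]
  rw [Finset.sum_eq_single (n - i)]
  · rw [coeff_C_mul, coeff_X_pow, if_pos rfl, mul_one]; congr 1; omega
  · intro b _ hb; rw [coeff_C_mul, coeff_X_pow, if_neg (Ne.symm hb), mul_zero]
  · intro hb; exact absurd (Finset.mem_range.2 (by omega)) hb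

/-- Data of the class map modulo `R_ℓ`. -/
structure SpCls (F : Type) [Field F] (ℓ : ℕ) (G : Type) [CommGroup G] where
  cls : F[X] → G
  one : cls 1 = 1
  mul : ∀ f g : F[X], f.Monic → g.Monic → cls (f * g) = cls f * cls g
  eqv : ∀ f g : F[X], f.Monic → g.Monic →
    (cls f = cls g ↔ ∀ i ≤ ℓ, f.reverse.coeff i = g.reverse.coeff i)
  surj : ∀ x : G, ∀ n, ℓ ≤ n → ∃ f : F[X], f.Monic ∧ f.natDegree = n ∧ cls f = x

theorem sp_group (F : Type) [Field F] [Fintype F] (ℓ : ℕ) :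
    ∃ (G : Type) (_ : CommGroup G) (_ : Finite G), Nonempty (SpCls F ℓ G) := by
  classical
  let I : Ideal (PowerSeries F) := Ideal.span {(PowerSeries.X : PowerSeries F) ^ (ℓ + 1)}
  let U : Subgroup (PowerSeries F)ˣ :=
    (Units.map (PowerSeries.constantCoeff (R := F) : PowerSeries F →* F)).ker
  let Θ : U →* (PowerSeries F ⧸ I)ˣ :=
    (Units.map (Ideal.Quotient.mk I : PowerSeries F →* PowerSeries F ⧸ I)).comp U.subtype
  have hunit : ∀ a : PowerSeries F, PowerSeries.constantCoeff a = 1 → ∃ u : U,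
      ((u : (PowerSeries F)ˣ) : PowerSeries F) = a := by
    intro a ha
    have h1 : IsUnit a := by
      rw [PowerSeries.isUnit_iff_constantCoeff, ha]; exact isUnit_one
    obtain ⟨u, rfl⟩ := h1
    refine ⟨⟨u, ?_⟩, rfl⟩
    rw [MonoidHom.mem_ker]
    ext
    exact ha
  choose! uu huu using hunit
  let φ : PowerSeries F → Θ.range := fun a => Θ.rangeRestrict (uu a)
  have hUeq : ∀ u v : U, ((u : (PowerSeries F)ˣ) : PowerSeries F) = ((v : (PowerSeries F)ˣ) : PowerSeries F) → u = v := by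
    intro u v h
    exact Subtype.ext (Units.ext h)
  have hφmul : ∀ a b, PowerSeries.constantCoeff a = 1 → PowerSeries.constantCoeff b = 1 →
      φ (a * b) = φ a * φ b := by
    intro a b ha hb
    simp only [φ]
    rw [← map_mul]
    congr 1
    apply hUeq
    rw [huu _ (by rw [map_mul, ha, hb, one_mul])]
    simp [huu a ha, huu b hb]
  have hφone : φ 1 = 1 := by
    simp only [φ]
    rw [← map_one Θ.rangeRestrict]
    congr 1
    apply hUeq
    rw [huu _ (by simp)]
    simp
  have hφeq : ∀ a b, PowerSeries.constantCoeff a = 1 → PowerSeries.constantCoeff b = 1 →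
      (φ a = φ b ↔ ∀ i ≤ ℓ, PowerSeries.coeff i a = PowerSeries.coeff i b) := by
    intro a b ha hb
    have h1 : φ a = φ b ↔ Ideal.Quotient.mk I a = Ideal.Quotient.mk I b := by
      rw [Subtype.ext_iff, Units.ext_iff]
      have h2 : ∀ c, PowerSeries.constantCoeff c = 1 →
          (((φ c : Θ.range) : (PowerSeries F ⧸ I)ˣ) : PowerSeries F ⧸ I) = Ideal.Quotient.mk I c := by
        intro c hc
        conv_rhs => rw [← huu c hc]
        rfl
      rw [h2 a ha, h2 b hb]
    rw [h1, Ideal.Quotient.eq, Ideal.mem_span_singleton, PowerSeries.X_pow_dvd_iff]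
    constructor
    · intro h i hi
      have := h i (by omega)
      rw [map_sub] at this
      exact sub_eq_zero.1 this
    · intro h i hi
      rw [map_sub, h i (by omega), sub_self]
  have hrev : ∀ f : F[X], f.Monic →
      PowerSeries.constantCoeff ((f.reverse : F[X]) : PowerSeries F) = 1 := by
    intro f hf
    rw [Polynomial.constantCoeff_coe, coeff_zero_reverse]
    exact hf
  let cls : F[X] → Θ.range := fun f => φ ((f.reverse : F[X]) : PowerSeries F)
  have heqv : ∀ f g : F[X], f.Monic → g.Monic →
      (cls f = cls g ↔ ∀ i ≤ ℓ, f.reverse.coeff i = g.reverse.coeff i) := by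
    intro f g hf hg
    simp only [cls]
    rw [hφeq _ _ (hrev f hf) (hrev g hg)]
    simp only [Polynomial.coeff_coe]
  have hsurj : ∀ x : Θ.range, ∀ n, ℓ ≤ n → ∃ f : F[X], f.Monic ∧ f.natDegree = n ∧ cls f = x := by
    intro x n hn
    obtain ⟨u, hu⟩ := Θ.rangeRestrict_surjective x
    set a : PowerSeries F := ((u : (PowerSeries F)ˣ) : PowerSeries F) with ha
    have ha1 : PowerSeries.constantCoeff a = 1 := by
      have := u.2
      rw [MonoidHom.mem_ker, Units.ext_iff] at this
      exact this
    obtain ⟨f, hf, hfn, hfa⟩ := sp_exists_monic n ℓ hn (fun i => PowerSeries.coeff i a)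
    refine ⟨f, hf, hfn, ?_⟩
    have h3 : x = φ a := by
      rw [← hu]
      simp only [φ]
      congr 1
      apply hUeq
      rw [huu a ha1]
    rw [h3]
    simp only [cls]
    rw [hφeq _ _ (hrev f hf) ha1]
    intro i hi
    rw [Polynomial.coeff_coe]
    rcases Nat.eq_zero_or_pos i with h0 | h0
    · subst h0
      rw [coeff_zero_reverse, hf.leadingCoeff, PowerSeries.coeff_zero_eq_constantCoeff_apply, ha1]
    · rw [sp_reverse_coeff _ _ (by omega), hfn, hfa i h0 hi]
  refine ⟨Θ.range, inferInstance, ?_, ⟨⟨cls, ?_, ?_, heqv, hsurj⟩⟩⟩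
  · have hs : Function.Surjective (fun f : spMon F ℓ => cls f.1) := by
      intro x
      obtain ⟨f, h1, h2, h3⟩ := hsurj x ℓ le_rfl
      exact ⟨⟨f, mem_spMon.2 ⟨h1, h2⟩⟩, h3⟩
    exact Finite.of_surjective _ hs
  · simp only [cls]
    rw [← C_1, reverse_C, C_1, Polynomial.coe_one, hφone]
  · intro f g hf hg
    simp only [cls]
    rw [reverse_mul_of_domain, Polynomial.coe_mul, hφmul _ _ (hrev f hf) (hrev g hg)]

section sp_cls

variable {F : Type} [Field F] [Fintype F] {ℓ : ℕ} {G : Type} [CommGroup G] (Q : SpCls F ℓ G)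

lemma SpCls.pow (f : F[X]) (hf : f.Monic) (e : ℕ) : Q.cls (f ^ e) = Q.cls f ^ e := by
  induction e with
  | zero => simp [Q.one]
  | succ e ih => rw [pow_succ, Q.mul _ _ (hf.pow e) hf, ih, pow_succ]

lemma SpCls.eqv_deg {f g : F[X]} {n : ℕ} (hn : ℓ ≤ n) (hf : f.Monic) (hg : g.Monic)
    (hfn : f.natDegree = n) (hgn : g.natDegree = n) :
    Q.cls f = Q.cls g ↔ ∀ i, 1 ≤ i → i ≤ ℓ → f.coeff (n - i) = g.coeff (n - i) := by
  rw [Q.eqv f g hf hg]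
  constructor
  · intro h i h1 h2
    have := h i h2
    rwa [sp_reverse_coeff _ _ (by omega), sp_reverse_coeff _ _ (by omega), hfn, hgn] at this
  · intro h i h2
    rcases Nat.eq_zero_or_pos i with h0 | h0
    · subst h0
      rw [coeff_zero_reverse, coeff_zero_reverse, hf.leadingCoeff, hg.leadingCoeff]
    · rw [sp_reverse_coeff _ _ (by omega), sp_reverse_coeff _ _ (by omega), hfn, hgn]
      exact h i h0 h2

open Classical in
lemma SpCls.fibre_le (n : ℕ) (hn : ℓ ≤ n) (x y : G) :
    ((spMon F n).filter (fun f => Q.cls f = x)).card ≤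
      ((spMon F n).filter (fun f => Q.cls f = y)).card := by
  obtain ⟨f0, h1, h2, h3⟩ := Q.surj x n hn
  obtain ⟨f1, h4, h5, h6⟩ := Q.surj y n hn
  apply Finset.card_le_card_of_injOn (fun f => f + (f1 - f0))
  · intro f hf
    rw [Finset.mem_coe, Finset.mem_filter, mem_spMon] at hf ⊢
    obtain ⟨⟨hm, hd⟩, hx⟩ := hf
    have hlt : (f1 - f0).degree < f.degree := by
      rw [degree_eq_natDegree hm.ne_zero, hd, ← h5, ← degree_eq_natDegree h4.ne_zero]
      apply degree_sub_lt_left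
      · rw [degree_eq_natDegree h4.ne_zero, degree_eq_natDegree h1.ne_zero, h5, h2]
      · exact h4.ne_zero
      · rw [h4.leadingCoeff, h1.leadingCoeff]
    have hm' : (f + (f1 - f0)).Monic := hm.add_of_left hlt
    have hd' : (f + (f1 - f0)).natDegree = n := by
      rw [natDegree_add_eq_left_of_degree_lt hlt, hd]
    refine ⟨⟨hm', hd'⟩, ?_⟩
    rw [← h6, Q.eqv_deg hn hm' h4 hd' h5]
    intro i hi1 hi2
    rw [← h3, Q.eqv_deg hn hm h1 hd h2] at hx
    rw [coeff_add, coeff_sub, hx i hi1 hi2]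
    ring
  · intro f _ g _ h
    exact add_right_cancel h

open Classical in
lemma SpCls.fibre_eq [Fintype G] (n : ℕ) (hn : ℓ ≤ n) (x : G) :
    Fintype.card G * ((spMon F n).filter (fun f => Q.cls f = x)).card = Fintype.card F ^ n := by
  rw [← card_spMon, Finset.card_eq_sum_card_fiberwise (s := spMon F n) (t := Finset.univ) (f := Q.cls)
    (fun _ _ => Finset.mem_coe.2 (Finset.mem_univ _))]
  rw [Finset.sum_congr rfl (fun y _ => le_antisymm (Q.fibre_le n hn y x) (Q.fibre_le n hn x y)),
    Finset.sum_const, smul_eq_mul, Finset.card_univ]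

lemma SpCls.card_eq (Q : SpCls F ℓ G) [Fintype G] : Fintype.card G = Fintype.card F ^ ℓ := by
  classical
  rw [← Q.fibre_eq ℓ le_rfl 1]
  have : ((spMon F ℓ).filter (fun f => Q.cls f = 1)).card = 1 := by
    rw [Finset.card_eq_one]
    obtain ⟨f0, h1, h2, h3⟩ := Q.surj 1 ℓ le_rfl
    refine ⟨f0, ?_⟩
    ext f
    rw [Finset.mem_filter, mem_spMon, Finset.mem_singleton]
    constructor
    · rintro ⟨⟨hm, hd⟩, hx⟩
      rw [← h3, Q.eqv_deg le_rfl hm h1 hd h2] at hx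
      ext i
      rcases lt_trichotomy i ℓ with h | h | h
      · have := hx (ℓ - i) (by omega) (by omega)
        rwa [show ℓ - (ℓ - i) = i by omega] at this
      · have e1 := hm.coeff_natDegree
        have e2 := h1.coeff_natDegree
        rw [hd, ← h] at e1
        rw [h2, ← h] at e2
        rw [e1, e2]
      · rw [coeff_eq_zero_of_natDegree_lt (by omega), coeff_eq_zero_of_natDegree_lt (by omega)]
    · rintro rfl
      exact ⟨⟨h1, h2⟩, h3⟩
  rw [this, mul_one]

end sp_cls

lemma sp_reverse_pow {K : Type} [Field K] (f : K[X]) (e : ℕ) :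
    (f ^ e).reverse = f.reverse ^ e := by
  induction e with
  | zero => rw [pow_zero, pow_zero, ← C_1, reverse_C]
  | succ e ih => rw [pow_succ, reverse_mul_of_domain, ih, pow_succ]

section sp_psi

variable {F : Type} [Field F] [Fintype F] {ℓ : ℕ} {G : Type} [CommGroup G] [Fintype G]
  (Q : SpCls F ℓ G)

open Classical in
/-- Number of prime powers in a class, weighted by degree. -/
noncomputable def SpCls.B (k : ℕ) (x : G) : ℕ :=
  ∑ d ∈ k.divisors, ∑ P ∈ (spIrr F d).filter (fun P => Q.cls P ^ (k / d) = x), d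

lemma spLam_divisors (w : F[X] → ℂ) (k : ℕ) :
    spLam w k k = ∑ d ∈ k.divisors, (d : ℂ) * ∑ P ∈ spIrr F d, w P ^ (k / d) := by
  rw [← Nat.sum_divisorsAntidiagonal (fun d e => (d : ℂ) * ∑ P ∈ spIrr F d, w P ^ e), spLam,
    Finset.filter_true_of_mem]
  rintro ⟨d, e⟩ hp
  rw [Nat.mem_divisorsAntidiagonal] at hp
  exact Nat.le_of_dvd (by omega) ⟨e, hp.1.symm⟩

/-- the weight attached to a character -/
noncomputable def SpCls.w (χ : AddChar (Additive G) ℂ) (f : F[X]) : ℂ := χ (Additive.ofMul (Q.cls f))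

lemma SpCls.w_one (χ : AddChar (Additive G) ℂ) : Q.w χ 1 = 1 := by
  simp [SpCls.w, Q.one]

lemma SpCls.w_mul (χ : AddChar (Additive G) ℂ) (f g : F[X]) (hf : f.Monic) (hg : g.Monic) :
    Q.w χ (f * g) = Q.w χ f * Q.w χ g := by
  rw [SpCls.w, Q.mul f g hf hg, ofMul_mul, AddChar.map_add_eq_mul]; rfl

lemma SpCls.lam_eq (χ : AddChar (Additive G) ℂ) (k : ℕ) :
    spLam (Q.w χ) k k = ∑ x : G, (Q.B k x : ℂ) * χ (Additive.ofMul x) := by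
  classical
  rw [spLam_divisors]
  simp only [SpCls.B, Nat.cast_sum, Finset.sum_mul]
  rw [Finset.sum_comm]
  apply Finset.sum_congr rfl
  intro d _
  rw [Finset.mul_sum]
  rw [← Finset.sum_fiberwise (s := spIrr F d) (g := fun P => Q.cls P ^ (k / d))]
  apply Finset.sum_congr rfl
  intro x _
  apply Finset.sum_congr rfl
  intro P hP
  rw [Finset.mem_filter] at hP
  rw [← hP.2, ofMul_pow, AddChar.map_nsmul_eq_pow]
  rfl

lemma SpCls.sum_B (k : ℕ) (hk : 1 ≤ k) : ∑ x : G, Q.B k x = Fintype.card F ^ k := by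
  have h1 := Q.lam_eq 1 k
  have h2 : (Q.w 1 : F[X] → ℂ) = fun _ => 1 := by
    funext f; simp [SpCls.w]
  rw [h2, spLam_one k hk] at h1
  simp only [AddChar.one_apply, mul_one] at h1
  exact_mod_cast h1.symm

lemma SpCls.B_le (h : ℕ) (hh : 0 < h) (x : G)
    (hlarge : spG (Fintype.card F) ℓ * spG (Fintype.card F) ℓ + 3 * spG (Fintype.card F) ℓ + 1 <
      Fintype.card F ^ h) :
    Fintype.card F ^ ℓ * Q.B (2 * h) x ≤ Fintype.card F ^ (2 * h) +
      (2 * spG (Fintype.card F) ℓ + 1) * Fintype.card F ^ h := by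
  classical
  obtain ⟨f0, h1, -, h3⟩ := Q.surj x ℓ le_rfl
  set T : Finset F[X] := (2 * h).divisors.biUnion
    (fun d => (spIrr F d).filter (fun P => Q.cls P ^ (2 * h / d) = x)) with hTdef
  have key := sp_count F (Fintype.card F) rfl ℓ h hh (fun j => f0.reverse.coeff j) T (by
    intro P hP
    rw [hTdef, Finset.mem_biUnion] at hP
    obtain ⟨d, hd, hP⟩ := hP
    rw [Finset.mem_filter, mem_spIrr] at hP
    obtain ⟨⟨hm, hdeg, hi⟩, hx⟩ := hP
    rw [Nat.mem_divisors] at hd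
    refine ⟨hm, hi, by rw [hdeg]; exact hd.1, ?_⟩
    rw [hdeg, ← sp_reverse_pow]
    rw [← h3, ← Q.pow P hm, Q.eqv _ _ (hm.pow _) h1] at hx
    exact hx) hlarge
  refine le_trans (le_of_eq ?_) key
  congr 1
  rw [hTdef, Finset.sum_biUnion, SpCls.B]
  · apply Finset.sum_congr rfl
    intro d _
    apply Finset.sum_congr rfl
    intro P hP
    rw [Finset.mem_filter, mem_spIrr] at hP
    exact hP.1.2.1.symm
  · intro d _ d' _ hne
    change Disjoint ((spIrr F d).filter (fun P => Q.cls P ^ (2 * h / d) = x))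
      ((spIrr F d').filter (fun P => Q.cls P ^ (2 * h / d') = x))
    rw [Finset.disjoint_left]
    intro P hP hP'
    rw [Finset.mem_filter, mem_spIrr] at hP hP'
    exact hne (hP.1.2.1.symm.trans hP'.1.2.1)

theorem SpCls.lam_bound (χ : AddChar (Additive G) ℂ) (hχ : χ ≠ 0) :
    ∃ (C : ℝ) (h0 : ℕ), ∀ h ≥ h0, ‖spLam (Q.w χ) (2 * h) (2 * h)‖ ≤ C * (Fintype.card F : ℝ) ^ h := by
  set q := Fintype.card F with hq
  have hq2 : 2 ≤ q := Fintype.one_lt_card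
  set g := spG q ℓ with hg
  refine ⟨(2 * g + 1 : ℕ), g * g + 3 * g + 2, ?_⟩
  intro h hh
  have hh0 : 0 < h := by omega
  have hlarge : g * g + 3 * g + 1 < q ^ h := by
    have h1 : h < 2 ^ h := Nat.lt_two_pow_self
    have h2 : 2 ^ h ≤ q ^ h := Nat.pow_le_pow_left hq2 h
    omega
  have hB := fun x => Q.B_le h hh0 x hlarge
  have hS := Q.sum_B (2 * h) (by omega)
  have hcard := Q.card_eq
  have hsum0 : ∑ x : G, χ (Additive.ofMul x) = 0 := by
    have h1 := AddChar.sum_eq_ite χ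
    rw [if_neg hχ] at h1
    rw [← h1]
    exact Fintype.sum_equiv Additive.ofMul _ _ (fun _ => rfl)
  have hqpos : (0 : ℝ) < (q : ℝ) ^ ℓ := by positivity
  set Mx : ℝ := ((q : ℝ) ^ (2 * h) + (2 * g + 1 : ℕ) * (q : ℝ) ^ h) / (q : ℝ) ^ ℓ with hMx
  have hle : ∀ x, (Q.B (2 * h) x : ℝ) ≤ Mx := by
    intro x
    rw [hMx, le_div_iff₀ hqpos, mul_comm]
    exact_mod_cast hB x
  rw [Q.lam_eq]
  have e1 : ∑ x : G, (Q.B (2 * h) x : ℂ) * χ (Additive.ofMul x) =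
      ∑ x : G, (((Q.B (2 * h) x : ℝ) - Mx : ℝ) : ℂ) * χ (Additive.ofMul x) := by
    have : ∑ x : G, (Mx : ℂ) * χ (Additive.ofMul x) = 0 := by
      rw [← Finset.mul_sum, hsum0, mul_zero]
    simp only [Complex.ofReal_sub, sub_mul, Finset.sum_sub_distrib, this, sub_zero,
      Complex.ofReal_natCast]
  rw [e1]
  refine (norm_sum_le _ _).trans ?_
  have e2 : ∀ x : G, ‖(((Q.B (2 * h) x : ℝ) - Mx : ℝ) : ℂ) * χ (Additive.ofMul x)‖ =
      Mx - (Q.B (2 * h) x : ℝ) := by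
    intro x
    rw [norm_mul, AddChar.norm_apply, mul_one, Complex.norm_real, Real.norm_eq_abs,
      abs_of_nonpos (by linarith [hle x])]
    ring
  rw [Finset.sum_congr rfl (fun x _ => e2 x), Finset.sum_sub_distrib, Finset.sum_const,
    Finset.card_univ, hcard, nsmul_eq_mul]
  have e3 : ∑ x : G, (Q.B (2 * h) x : ℝ) = (q : ℝ) ^ (2 * h) := by exact_mod_cast hS
  rw [e3, hMx, Nat.cast_pow, mul_div_cancel₀ _ hqpos.ne']
  linarith

end sp_psi

lemma sp_power_sum_bound (S : Multiset ℂ) (C q : ℝ) (hq : 0 < q) (h0 : ℕ)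
    (hb : ∀ h ≥ h0, ‖(S.map (fun β => β ^ h)).sum‖ ≤ C * q ^ h) : ∀ β ∈ S, ‖β‖ ≤ q := by
  classical
  intro β1 hβ1
  by_contra hcon
  push Not at hcon
  set p : ℂ[X] := ∏ β ∈ S.toFinset.erase β1, (X - Polynomial.C β) with hp
  have hp1 : p.eval β1 ≠ 0 := by
    rw [hp, eval_prod, Finset.prod_ne_zero_iff]
    intro β hβ
    rw [Finset.mem_erase] at hβ
    rw [eval_sub, eval_X, eval_C, sub_ne_zero]
    exact hβ.1.symm
  have hp2 : ∀ β ∈ S, β ≠ β1 → p.eval β = 0 := by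
    intro β hβ hne
    rw [hp, eval_prod]
    apply Finset.prod_eq_zero (i := β)
    · rw [Finset.mem_erase]; exact ⟨hne, Multiset.mem_toFinset.2 hβ⟩
    · simp
  have key : ∀ h, ∑ j ∈ Finset.range (p.natDegree + 1), p.coeff j *
      (S.map (fun β => β ^ (h + j))).sum = (S.count β1 : ℂ) * (β1 ^ h * p.eval β1) := by
    intro h
    have h1 : ∑ j ∈ Finset.range (p.natDegree + 1), p.coeff j *
        (S.map (fun β => β ^ (h + j))).sum = (S.map (fun β => β ^ h * p.eval β)).sum := by
      simp only [← Multiset.sum_map_mul_left]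
      rw [← Multiset.sum_map_sum]
      congr 1
      apply Multiset.map_congr rfl
      intro β _
      rw [eval_eq_sum_range, Finset.mul_sum]
      apply Finset.sum_congr rfl
      intro j _
      ring
    rw [h1, Finset.sum_multiset_map_count, Finset.sum_eq_single β1]
    · rw [nsmul_eq_mul]
    · intro β hβ hne
      rw [hp2 β (Multiset.mem_toFinset.1 hβ) hne]; simp
    · intro h; exact absurd (Multiset.mem_toFinset.2 hβ1) h
  set D : ℝ := ∑ j ∈ Finset.range (p.natDegree + 1), ‖p.coeff j‖ * (C * q ^ j) with hD
  have hbound : ∀ h ≥ h0, ‖β1‖ ^ h * ‖p.eval β1‖ ≤ D * q ^ h := by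
    intro h hh
    have h2 : ‖(S.count β1 : ℂ) * (β1 ^ h * p.eval β1)‖ ≤ D * q ^ h := by
      rw [← key h, hD, Finset.sum_mul]
      refine (norm_sum_le _ _).trans (Finset.sum_le_sum ?_)
      intro j _
      rw [norm_mul, mul_assoc, mul_assoc, ← pow_add, add_comm j h]
      exact mul_le_mul_of_nonneg_left (hb _ (by omega)) (norm_nonneg _)
    rw [norm_mul, norm_mul, norm_pow, Complex.norm_natCast] at h2
    refine le_trans ?_ h2
    have h3 : (1 : ℝ) ≤ S.count β1 := by exact_mod_cast Multiset.one_le_count_iff_mem.2 hβ1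
    exact le_mul_of_one_le_left (by positivity) h3
  have hr : 1 < ‖β1‖ / q := by rw [lt_div_iff₀ hq]; linarith
  have hpos : 0 < ‖p.eval β1‖ := norm_pos_iff.2 hp1
  obtain ⟨n, hn⟩ := pow_unbounded_of_one_lt (D / ‖p.eval β1‖) hr
  have h4 : (‖β1‖ / q) ^ n ≤ (‖β1‖ / q) ^ (max n h0) := pow_le_pow_right₀ hr.le (le_max_left _ _)
  have h5 := hbound (max n h0) (le_max_right _ _)
  have h6 : (‖β1‖ / q) ^ (max n h0) ≤ D / ‖p.eval β1‖ := by
    rw [div_pow, div_le_div_iff₀ (by positivity) hpos]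
    exact h5
  linarith

/-- Power sum generating function. -/
noncomputable def spPS (s : Multiset ℂ) : PowerSeries ℂ :=
  PowerSeries.mk (fun j => if j = 0 then 0 else (s.map (fun γ => γ ^ j)).sum)

lemma spPS_single (γ : ℂ) : spPS {γ} * (1 - PowerSeries.C γ * PowerSeries.X) =
    PowerSeries.C γ * PowerSeries.X := by
  ext n
  rw [mul_sub, mul_one, map_sub, mul_left_comm, PowerSeries.coeff_C_mul, PowerSeries.coeff_C_mul]
  cases n with
  | zero => simp [spPS]
  | succ n =>
    rw [PowerSeries.coeff_succ_mul_X]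
    simp only [spPS, PowerSeries.coeff_mk, PowerSeries.coeff_X, Multiset.map_singleton,
      Multiset.sum_singleton]
    cases n with
    | zero => simp
    | succ n => simp; ring

lemma sp_newton (s : Multiset ℂ) :
    ((X * derivative (s.map (fun γ => (1 - C γ * X : ℂ[X]))).prod : ℂ[X]) : PowerSeries ℂ) =
      - spPS s * (((s.map (fun γ => (1 - C γ * X : ℂ[X]))).prod : ℂ[X]) : PowerSeries ℂ) := by
  induction s using Multiset.induction_on with
  | empty =>
    have : spPS 0 = 0 := by ext n; simp [spPS]
    simp [this]
  | cons γ s ih =>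
    have hadd : spPS (γ ::ₘ s) = spPS {γ} + spPS s := by
      ext n
      simp only [spPS, map_add, PowerSeries.coeff_mk, Multiset.map_cons, Multiset.sum_cons,
        Multiset.map_singleton, Multiset.sum_singleton]
      split_ifs <;> simp
    have h1 := spPS_single γ
    rw [Multiset.map_cons, Multiset.prod_cons, derivative_mul]
    simp only [derivative_sub, derivative_one, derivative_mul, derivative_C, derivative_X, zero_mul,
      mul_one, zero_add, zero_sub]
    simp only [Polynomial.coe_mul, Polynomial.coe_add, Polynomial.coe_sub, Polynomial.coe_one,
      Polynomial.coe_C, Polynomial.coe_X, Polynomial.coe_neg] at ih ⊢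
    rw [hadd]
    linear_combination (1 - PowerSeries.C γ * PowerSeries.X) * ih +
      (((s.map (fun γ => (1 - C γ * X : ℂ[X]))).prod : ℂ[X]) : PowerSeries ℂ) * h1

lemma sp_factor_one (L : ℂ[X]) (hL : L.coeff 0 = 1) : ∃ s : Multiset ℂ, s.card ≤ L.natDegree ∧
    L = (s.map (fun γ => (1 - C γ * X : ℂ[X]))).prod := by
  have hL0 : L ≠ 0 := by rintro rfl; simp at hL
  have hr : ∀ r ∈ L.roots, r ≠ 0 := by
    rintro r hr rfl
    rw [mem_roots hL0, IsRoot, ← coeff_zero_eq_eval_zero, hL] at hr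
    exact one_ne_zero hr
  have h1 : L = C L.leadingCoeff * (L.roots.map (fun a => X - C a)).prod :=
    (IsAlgClosed.splits L).eq_prod_roots
  refine ⟨L.roots.map (fun r => r⁻¹), by rw [Multiset.card_map]; exact card_roots' L, ?_⟩
  rw [Multiset.map_map]
  have h2 : (L.roots.map (fun a => X - C a)).prod =
      C (L.roots.map (fun a => -a)).prod *
        (L.roots.map ((fun γ => (1 - C γ * X : ℂ[X])) ∘ fun r => r⁻¹)).prod := by
    have : C (L.roots.map (fun a => -a)).prod = (L.roots.map (fun a => C (-a))).prod := by
      rw [← Multiset.prod_hom]; simp [Multiset.map_map]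
    rw [this, ← Multiset.prod_map_mul]
    congr 1
    apply Multiset.map_congr rfl
    intro r hr'
    simp only [Function.comp]
    have h3 : (C r : ℂ[X]) * C r⁻¹ = 1 := by
      rw [← C_mul, mul_inv_cancel₀ (hr r hr'), C_1]
    rw [C_neg]
    linear_combination (-X) * h3
  set M := (L.roots.map ((fun γ => (1 - C γ * X : ℂ[X])) ∘ fun r => r⁻¹)).prod with hM
  have h4 : M.coeff 0 = 1 := by
    rw [coeff_zero_eq_eval_zero, hM, eval_multiset_prod, Multiset.map_map]
    simp
  rw [h2, ← mul_assoc, ← C_mul] at h1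
  have h5 := hL
  rw [h1, coeff_C_mul, h4, mul_one] at h5
  rw [h5, C_1, one_mul] at h1
  exact h1

lemma sp_conv_unique (a b c : ℕ → ℂ) (hc : c 0 = 1)
    (h : ∀ k, 1 ≤ k → ∑ j ∈ Finset.Icc 1 k, a j * c (k - j) = ∑ j ∈ Finset.Icc 1 k, b j * c (k - j)) :
    ∀ k, 1 ≤ k → a k = b k := by
  intro k
  induction k using Nat.strong_induction_on with
  | _ k ih =>
    intro hk
    obtain ⟨k, rfl⟩ : ∃ k', k = k' + 1 := ⟨k - 1, by omega⟩
    have h1 := h (k + 1) hk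
    rw [Finset.sum_Icc_succ_top (by omega), Finset.sum_Icc_succ_top (by omega)] at h1
    have h2 : ∑ j ∈ Finset.Icc 1 k, a j * c (k + 1 - j) =
        ∑ j ∈ Finset.Icc 1 k, b j * c (k + 1 - j) := by
      apply Finset.sum_congr rfl
      intro j hj
      rw [Finset.mem_Icc] at hj
      rw [ih j (by omega) hj.1]
    rw [h2, Nat.sub_self, hc, mul_one, mul_one] at h1
    exact add_left_cancel h1

section sp_psi2

variable {F : Type} [Field F] [Fintype F] {ℓ : ℕ} {G : Type} [CommGroup G] [Fintype G]
  (Q : SpCls F ℓ G)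

lemma SpCls.mon_sum_zero (χ : AddChar (Additive G) ℂ) (hχ : χ ≠ 0) (k : ℕ) (hk : ℓ ≤ k) :
    spS (Q.w χ) k k = 0 := by
  classical
  have hsum0 : ∑ x : G, χ (Additive.ofMul x) = 0 := by
    have h1 := AddChar.sum_eq_ite χ
    rw [if_neg hχ] at h1
    rw [← h1]
    exact Fintype.sum_equiv Additive.ofMul _ _ (fun _ => rfl)
  rw [spS, spSm_of_le le_rfl, ← Finset.sum_fiberwise (s := spMon F k) (g := fun f => Q.cls f)]
  have h1 : ∀ x : G, (Fintype.card G : ℂ) *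
      ∑ f ∈ (spMon F k).filter (fun f => Q.cls f = x), Q.w χ f =
      (Fintype.card F : ℂ) ^ k * χ (Additive.ofMul x) := by
    intro x
    have h2 : ∑ f ∈ (spMon F k).filter (fun f => Q.cls f = x), Q.w χ f =
        (((spMon F k).filter (fun f => Q.cls f = x)).card : ℂ) * χ (Additive.ofMul x) := by
      rw [← nsmul_eq_mul, ← Finset.sum_const]
      apply Finset.sum_congr rfl
      intro f hf
      rw [Finset.mem_filter] at hf
      rw [SpCls.w, hf.2]
    have h3 := Q.fibre_eq k hk x
    rw [h2, ← mul_assoc]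
    congr 1
    have h4 : ((Fintype.card G * ((spMon F k).filter (fun f => Q.cls f = x)).card : ℕ) : ℂ) =
        ((Fintype.card F ^ k : ℕ) : ℂ) := by
      rw [← h3]
    push_cast at h4
    exact h4
  have h5 : (Fintype.card G : ℂ) *
      ∑ x : G, ∑ f ∈ (spMon F k).filter (fun f => Q.cls f = x), Q.w χ f = 0 := by
    rw [Finset.mul_sum, Finset.sum_congr rfl (fun x _ => h1 x), ← Finset.mul_sum, hsum0, mul_zero]
  rcases mul_eq_zero.1 h5 with h6 | h6
  · exact absurd h6 (by exact_mod_cast Fintype.card_ne_zero)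
  · exact h6

lemma spS_of_le (w : F[X] → ℂ) {k m : ℕ} (h : k ≤ m) : spS w m k = spS w k k := by
  rw [spS, spS, spSm_of_le h, spSm_of_le le_rfl]

lemma SpCls.psi_bound (hℓ : 1 ≤ ℓ) (χ : AddChar (Additive G) ℂ) (hχ : χ ≠ 0) (k : ℕ) (hk : 1 ≤ k) :
    ‖spLam (Q.w χ) k k‖ ≤ ℓ * Real.sqrt (Fintype.card F) ^ k := by
  set w := Q.w χ with hw
  have hw1 : w 1 = 1 := Q.w_one χ
  have hwm := Q.w_mul χ
  set c : ℕ → ℂ := fun k => spS w k k with hc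
  have hc0 : c 0 = 1 := spS_zero w hw1 0
  set L : ℂ[X] := ∑ k ∈ Finset.range ℓ, C (c k) * X ^ k with hL
  have hLc : ∀ k, L.coeff k = c k := by
    intro k
    rw [hL, finset_sum_coeff]
    simp only [coeff_C_mul, coeff_X_pow, mul_ite, mul_one, mul_zero]
    rw [Finset.sum_ite_eq]
    split_ifs with h
    · rfl
    · rw [Finset.mem_range, not_lt] at h
      exact (Q.mon_sum_zero χ hχ k h).symm
  have hLd : L.natDegree ≤ ℓ := by
    rw [natDegree_le_iff_coeff_eq_zero]
    intro N hN
    rw [hLc]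
    exact Q.mon_sum_zero χ hχ N hN.le
  obtain ⟨s, hs1, hs2⟩ := sp_factor_one L (by rw [hLc, hc0])
  have hpsi : ∀ k, 1 ≤ k → spLam w k k = - (s.map (fun γ => γ ^ k)).sum := by
    apply sp_conv_unique (fun k => spLam w k k) (fun k => - (s.map (fun γ => γ ^ k)).sum) c hc0
    intro k hk
    have h1 := sp_identity w hw1 hwm k k
    have h2 : ∑ j ∈ Finset.Icc 1 k, spLam w k j * spS w k (k - j) =
        ∑ j ∈ Finset.Icc 1 k, spLam w j j * c (k - j) := by
      apply Finset.sum_congr rfl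
      intro j hj
      rw [Finset.mem_Icc] at hj
      rw [spLam_of_le w hj.2, spS_of_le w (Nat.sub_le k j)]
    rw [h2] at h1
    rw [← h1]
    have h3 := congrArg (PowerSeries.coeff k) (sp_newton s)
    rw [← hs2, Polynomial.coeff_coe, PowerSeries.coeff_mul,
      Finset.Nat.sum_antidiagonal_eq_sum_range_succ
        (fun i j => PowerSeries.coeff i (-spPS s) * PowerSeries.coeff j (L : PowerSeries ℂ)),
      Finset.sum_range_succ'] at h3
    obtain ⟨k, rfl⟩ : ∃ k', k = k' + 1 := ⟨k - 1, by omega⟩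
    rw [coeff_X_mul, coeff_derivative, hLc] at h3
    have h4 : c (k + 1) * ((k : ℂ) + 1) = ((k + 1 : ℕ) : ℂ) * spS w (k + 1) (k + 1) := by
      push_cast; rw [hc]; ring
    rw [h4] at h3
    rw [h3]
    have h5 : PowerSeries.coeff 0 (-spPS s) = 0 := by simp [spPS]
    rw [h5, zero_mul, add_zero, Finset.range_eq_Ico, Finset.sum_Ico_add'
      (fun i => PowerSeries.coeff i (-spPS s) * PowerSeries.coeff (k + 1 - i) (L : PowerSeries ℂ)) 0 (k + 1) 1]
    apply Finset.sum_congr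
    · ext; simp
    · intro j hj
      rw [Finset.mem_Icc] at hj
      rw [Polynomial.coeff_coe, hLc, map_neg, spPS, PowerSeries.coeff_mk, if_neg (by omega)]
  have hq0 : (0 : ℝ) < Fintype.card F := by exact_mod_cast Fintype.card_pos
  have hγ : ∀ γ ∈ s, ‖γ‖ ≤ Real.sqrt (Fintype.card F) := by
    obtain ⟨C, h0, hC⟩ := Q.lam_bound χ hχ
    have h1 := sp_power_sum_bound (s.map (fun γ => γ ^ 2)) C (Fintype.card F) hq0 (h0 + 1) (by
      intro h hh
      have h2 := hC h (by omega)
      rw [← hw, hpsi (2 * h) (by omega), norm_neg] at h2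
      rw [Multiset.map_map]
      refine le_trans (le_of_eq ?_) h2
      congr 3
      funext γ
      simp only [Function.comp, pow_mul])
    intro γ hγ
    have h3 := h1 (γ ^ 2) (Multiset.mem_map_of_mem _ hγ)
    rw [norm_pow] at h3
    exact Real.le_sqrt_of_sq_le h3
  rw [hpsi k hk, norm_neg]
  have h7 : ∀ t : Multiset ℂ, (∀ γ ∈ t, ‖γ‖ ≤ Real.sqrt (Fintype.card F)) →
      ‖(t.map (fun γ => γ ^ k)).sum‖ ≤ t.card * Real.sqrt (Fintype.card F) ^ k := by
    intro t
    induction t using Multiset.induction_on with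
    | empty => intro _; simp
    | cons γ t ih =>
      intro ht
      rw [Multiset.map_cons, Multiset.sum_cons, Multiset.card_cons]
      have h8 := ih (fun γ hγ => ht γ (Multiset.mem_cons_of_mem hγ))
      have h9 := pow_le_pow_left₀ (norm_nonneg γ) (ht γ (Multiset.mem_cons_self γ t)) k
      refine (norm_add_le _ _).trans ?_
      rw [norm_pow]
      push_cast
      linarith
  refine (h7 s hγ).trans ?_
  have h10 : (s.card : ℝ) ≤ ℓ := by exact_mod_cast hs1.trans hLd
  exact mul_le_mul_of_nonneg_right h10 (by positivity)

end sp_psi2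

lemma sp_gronwall (s lam : ℕ → ℂ) (μ : ℕ → ℝ) (B R : ℝ) (hR : 0 < R) (hB : 0 ≤ B)
    (hμ : ∀ j, 0 ≤ μ j) (hμB : ∀ n, ∑ j ∈ Finset.Icc 1 n, μ j ≤ B)
    (hlam : ∀ j, 1 ≤ j → ‖lam j‖ ≤ μ j * R ^ j) (hs0 : s 0 = 1)
    (hrec : ∀ n : ℕ, (n : ℂ) * s n = ∑ j ∈ Finset.Icc 1 n, lam j * s (n - j)) (n : ℕ) :
    ‖s n‖ ≤ R ^ n * Real.exp B := by
  set E : ℕ → ℝ := fun n => ∑ k ∈ Finset.range (n + 1), B ^ k / (k.factorial : ℝ) with hE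
  have hEmono : Monotone E := by
    intro a b hab
    apply Finset.sum_le_sum_of_subset_of_nonneg
    · intro x hx; rw [Finset.mem_range] at hx ⊢; omega
    · intro i _ _; positivity
  have hE0 : ∀ n, 0 ≤ E n := fun n => Finset.sum_nonneg (fun i _ => by positivity)
  have hEstep : ∀ n, B * E n ≤ ((n + 1 : ℕ) : ℝ) * E (n + 1) := by
    intro n
    simp only [hE]
    rw [Finset.sum_range_succ' _ (n + 1), mul_add, Finset.mul_sum, Finset.mul_sum]
    refine le_trans (Finset.sum_le_sum ?_) (le_add_of_nonneg_right (by positivity))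
    intro k hk
    rw [Finset.mem_range] at hk
    have h1 : B * (B ^ k / (k.factorial : ℝ)) = ((k + 1 : ℕ) : ℝ) * (B ^ (k + 1) / ((k + 1).factorial : ℝ)) := by
      rw [Nat.factorial_succ]
      have : (k.factorial : ℝ) ≠ 0 := by exact_mod_cast Nat.factorial_ne_zero k
      have : ((k + 1 : ℕ) : ℝ) ≠ 0 := by positivity
      push_cast at *
      field_simp
      try ring
    rw [h1]
    apply mul_le_mul_of_nonneg_right _ (by positivity)
    exact_mod_cast hk
  have main : ∀ n, ‖s n‖ ≤ R ^ n * E n := by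
    intro n
    induction n using Nat.strong_induction_on with
    | _ n ih =>
      cases n with
      | zero => simp [hs0, hE]
      | succ n =>
        have h1 : ((n + 1 : ℕ) : ℝ) * ‖s (n + 1)‖ ≤ R ^ (n + 1) * (B * E n) := by
          have h2 : ((n + 1 : ℕ) : ℝ) * ‖s (n + 1)‖ = ‖((n + 1 : ℕ) : ℂ) * s (n + 1)‖ := by
            rw [norm_mul, Complex.norm_natCast]
          rw [h2, hrec]
          have h3 : ∀ j ∈ Finset.Icc 1 (n + 1), ‖lam j * s (n + 1 - j)‖ ≤ μ j * (R ^ (n + 1) * E n) := by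
            intro j hj
            rw [Finset.mem_Icc] at hj
            have h4 := ih (n + 1 - j) (by omega)
            have h5 : E (n + 1 - j) ≤ E n := hEmono (by omega)
            have h6 : R ^ (n + 1) = R ^ j * R ^ (n + 1 - j) := by
              rw [← pow_add]; congr 1; omega
            rw [norm_mul, h6]
            calc ‖lam j‖ * ‖s (n + 1 - j)‖ ≤ (μ j * R ^ j) * (R ^ (n + 1 - j) * E n) := by
                  apply mul_le_mul (hlam j hj.1) _ (norm_nonneg _)
                    (mul_nonneg (hμ j) (by positivity))
                  exact h4.trans (mul_le_mul_of_nonneg_left h5 (by positivity))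
              _ = _ := by ring
          refine (norm_sum_le _ _).trans ((Finset.sum_le_sum h3).trans ?_)
          rw [← Finset.sum_mul]
          have h7 := mul_le_mul_of_nonneg_right (hμB (n + 1))
            (mul_nonneg (pow_pos hR (n + 1)).le (hE0 n))
          linarith
        have h8 := mul_le_mul_of_nonneg_left (hEstep n) (pow_pos hR (n + 1)).le
        have h9 : (0 : ℝ) < ((n + 1 : ℕ) : ℝ) := by positivity
        apply le_of_mul_le_mul_left _ h9
        linarith
  refine (main n).trans (mul_le_mul_of_nonneg_left ?_ (by positivity))
  exact Real.sum_le_exp_of_nonneg hB (n + 1)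

section sp_lam

variable {F : Type} [Field F] [Fintype F]

lemma sp_irr_sum (j : ℕ) (hj : 1 ≤ j) :
    ∑ d ∈ j.divisors, (d : ℝ) * (spIrr F d).card = (Fintype.card F : ℝ) ^ j := by
  have h1 := spLam_one (F := F) j hj
  rw [spLam_divisors] at h1
  simp only [one_pow, Finset.sum_const, nsmul_eq_mul, mul_one] at h1
  exact_mod_cast h1

lemma sp_irr_le (d : ℕ) (hd : 1 ≤ d) : (d : ℝ) * (spIrr F d).card ≤ (Fintype.card F : ℝ) ^ d := by
  rw [← sp_irr_sum d hd]
  exact Finset.single_le_sum (f := fun d : ℕ => (d : ℝ) * (spIrr F d).card)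
    (fun i _ => by positivity) (by simp; omega)

lemma spLam_norm (w : F[X] → ℂ) (hw : ∀ f, ‖w f‖ = 1) (m j : ℕ) :
    ‖spLam w m j‖ ≤ ∑ d ∈ j.divisors.filter (fun d => d ≤ m), (d : ℝ) * (spIrr F d).card := by
  have h1 : spLam w m j = ∑ d ∈ j.divisors.filter (fun d => d ≤ m),
      (d : ℂ) * ∑ P ∈ spIrr F d, w P ^ (j / d) := by
    rw [spLam, Finset.sum_filter, Finset.sum_filter,
      ← Nat.sum_divisorsAntidiagonal (fun d e => if d ≤ m then (d : ℂ) * ∑ P ∈ spIrr F d, w P ^ e else 0)]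
  rw [h1]
  refine (norm_sum_le _ _).trans (Finset.sum_le_sum ?_)
  intro d _
  rw [norm_mul, Complex.norm_natCast]
  apply mul_le_mul_of_nonneg_left _ (by positivity)
  refine (norm_sum_le _ _).trans ?_
  simp [hw]

lemma spLam_le_pow (w : F[X] → ℂ) (hw : ∀ f, ‖w f‖ = 1) (m j : ℕ) (hj : 1 ≤ j) :
    ‖spLam w m j‖ ≤ (Fintype.card F : ℝ) ^ j := by
  refine (spLam_norm w hw m j).trans ?_
  rw [← sp_irr_sum j hj]
  exact Finset.sum_le_sum_of_subset_of_nonneg (Finset.filter_subset _ _) (fun i _ _ => by positivity)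

lemma sp_geom_le (q : ℝ) (hq : 2 ≤ q) (n : ℕ) : ∑ d ∈ Finset.range (n + 1), q ^ d ≤ 2 * q ^ n := by
  induction n with
  | zero => simp
  | succ n ih =>
    rw [Finset.sum_range_succ, pow_succ]
    have : 0 < q ^ n := by positivity
    nlinarith

lemma spLam_le_half (w : F[X] → ℂ) (hw : ∀ f, ‖w f‖ = 1) (m j : ℕ) (hj : m < j) :
    ‖spLam w m j‖ ≤ 2 * Real.sqrt (Fintype.card F) ^ j := by
  have hq2 : (2 : ℝ) ≤ Fintype.card F := by exact_mod_cast (Fintype.one_lt_card : 1 < Fintype.card F)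
  refine (spLam_norm w hw m j).trans ?_
  have h1 : ∑ d ∈ j.divisors.filter (fun d => d ≤ m), (d : ℝ) * (spIrr F d).card ≤
      ∑ d ∈ j.divisors.filter (fun d => d ≤ m), (Fintype.card F : ℝ) ^ d := by
    apply Finset.sum_le_sum
    intro d hd
    rw [Finset.mem_filter] at hd
    exact sp_irr_le d (Nat.pos_of_mem_divisors hd.1)
  have h2 : ∑ d ∈ j.divisors.filter (fun d => d ≤ m), (Fintype.card F : ℝ) ^ d ≤
      ∑ d ∈ Finset.range (j / 2 + 1), (Fintype.card F : ℝ) ^ d := by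
    apply Finset.sum_le_sum_of_subset_of_nonneg
    · intro d hd
      rw [Finset.mem_filter, Nat.mem_divisors] at hd
      obtain ⟨⟨⟨e, he⟩, h0⟩, hdm⟩ := hd
      rw [Finset.mem_range, Nat.lt_succ_iff, Nat.le_div_iff_mul_le (by norm_num)]
      have : 2 ≤ e := by
        by_contra hc
        have : e = 0 ∨ e = 1 := by omega
        rcases this with rfl | rfl
        · simp at he; omega
        · simp at he; omega
      calc d * 2 ≤ d * e := Nat.mul_le_mul_left d this
        _ = j := he.symm
    · intro i _ _; positivity
  refine h1.trans (h2.trans ((sp_geom_le _ hq2 _).trans ?_))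
  have h3 : (Fintype.card F : ℝ) ^ (j / 2) = Real.sqrt (Fintype.card F) ^ (2 * (j / 2)) := by
    rw [pow_mul, Real.sq_sqrt (by linarith)]
  rw [h3]
  apply mul_le_mul_of_nonneg_left _ (by norm_num)
  apply pow_le_pow_right₀ _ (Nat.mul_div_le j 2)
  rw [Real.one_le_sqrt]; linarith

end sp_lam

lemma sp_sum_geom (r : ℝ) (h0 : 0 ≤ r) (h1 : r < 1) (n : ℕ) :
    ∑ j ∈ Finset.Icc 1 n, r ^ j ≤ 1 / (1 - r) := by
  have h2 : ∑ j ∈ Finset.Icc 1 n, r ^ j ≤ ∑ j ∈ Finset.range (n + 1), r ^ j := by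
    apply Finset.sum_le_sum_of_subset_of_nonneg
    · intro x hx; rw [Finset.mem_Icc] at hx; rw [Finset.mem_range]; omega
    · intro i _ _; positivity
  refine h2.trans ?_
  rw [one_div, ← tsum_geometric_of_lt_one h0 h1]
  exact (summable_geometric_of_lt_one h0 h1).sum_le_tsum _ (fun i _ => by positivity)

theorem sp_char_bound (ε : ℝ) (hε : 0 < ε) : ∃ C0 : ℝ, ∀ (F : Type) [Field F] [Fintype F]
    (ℓ : ℕ) (G : Type) [CommGroup G] [Fintype G] (Q : SpCls F ℓ G) (_ : 1 ≤ ℓ)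
    (χ : AddChar (Additive G) ℂ) (_ : χ ≠ 0) (n m : ℕ),
    ‖spS (Q.w χ) m n‖ ≤ (Fintype.card F : ℝ) ^ ((1 / 2 + ε) * (n : ℝ)) * Real.exp (C0 + ε * ℓ) := by
  set r : ℝ := (2 : ℝ) ^ (-(ε / 2)) with hr
  have hr0 : 0 < r := Real.rpow_pos_of_pos (by norm_num) _
  have hr1 : r < 1 := Real.rpow_lt_one_of_one_lt_of_neg (by norm_num) (by linarith)
  set K : ℝ := 1 / (1 - r) with hK
  have hK0 : 0 < K := one_div_pos.2 (by linarith)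
  set δ : ℝ := ε / K with hδ
  have hδ0 : 0 < δ := div_pos hε hK0
  set D : ℝ := (1 / δ) ^ (1 / ε) with hD
  have hD0 : 0 < D := Real.rpow_pos_of_pos (by positivity) _
  refine ⟨(2 + D) * K, ?_⟩
  intro F _ _ ℓ G _ _ Q hℓ χ hχ n m
  set q : ℝ := (Fintype.card F : ℝ) with hq
  have hq2 : (2 : ℝ) ≤ q := by rw [hq]; exact_mod_cast (Fintype.one_lt_card : 1 < Fintype.card F)
  have hq0 : 0 < q := by linarith
  set w := Q.w χ with hw
  have hwn : ∀ f, ‖w f‖ = 1 := fun f => AddChar.norm_apply χ _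
  set u : ℝ := q ^ (ε / 2) with hu
  have hu1 : 1 ≤ u := Real.one_le_rpow (by linarith) (by linarith)
  have hur : 1 ≤ r * u := by
    have h1 : (2 : ℝ) ^ (ε / 2) ≤ u := Real.rpow_le_rpow (by norm_num) hq2 (by linarith)
    have h2 : r * (2 : ℝ) ^ (ε / 2) = 1 := by
      rw [hr, ← Real.rpow_add (by norm_num)]; simp
    nlinarith
  set R : ℝ := q ^ (1 / 2 + ε) with hR
  have hRu : R = Real.sqrt q * (u * u) := by
    rw [hR, Real.sqrt_eq_rpow, hu, ← Real.rpow_add hq0, ← Real.rpow_add hq0]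
    congr 1; ring
  have hR0 : 0 < R := Real.rpow_pos_of_pos hq0 _
  have hB : (2 + D) * K + ε * ℓ = (2 + D + δ * ℓ) * K := by
    rw [hδ]; field_simp
  rw [Real.rpow_mul hq0.le, Real.rpow_natCast, hB]
  apply sp_gronwall (fun n => spS w m n) (fun j => spLam w m j)
    (fun j => (2 + D + δ * ℓ) * r ^ j) ((2 + D + δ * ℓ) * K) R hR0 (by positivity)
  · intro j; positivity
  · intro n
    rw [← Finset.mul_sum]
    exact mul_le_mul_of_nonneg_left (sp_sum_geom r hr0.le hr1 n) (by positivity)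
  · intro j hj
    set y : ℝ := Real.sqrt q ^ j with hy
    have hy0 : 0 < y := pow_pos (Real.sqrt_pos.2 hq0) j
    have hRj : R ^ j = y * (u ^ j * u ^ j) := by rw [hRu, mul_pow, mul_pow]
    have huj : 1 ≤ u ^ j := one_le_pow₀ hu1
    have hurj : 1 ≤ r ^ j * u ^ j := by rw [← mul_pow]; exact one_le_pow₀ hur
    have hbig : u ^ j ≤ r ^ j * (u ^ j * u ^ j) := by nlinarith
    set Z : ℝ := r ^ j * (u ^ j * u ^ j) with hZ
    have hgoal : (2 + D + δ * ℓ) * r ^ j * R ^ j = 2 * y * Z + D * y * Z + δ * ℓ * y * Z := by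
      rw [hRj, hZ]; ring
    change ‖spLam w m j‖ ≤ (2 + D + δ * ℓ) * r ^ j * R ^ j
    rw [hgoal]
    have hZ1 : 1 ≤ Z := huj.trans hbig
    have e1 : 0 ≤ 2 * y * Z := by positivity
    have e2 : 0 ≤ D * y * Z := by positivity
    have e3 : 0 ≤ δ * ℓ * y * Z := by positivity
    by_cases hjm : j ≤ m
    · by_cases hc : 1 / δ ≤ u ^ j
      · have h1 := Q.psi_bound hℓ χ hχ j hj
        rw [← hw, ← spLam_of_le w hjm] at h1
        have h2 : 1 ≤ δ * Z := by
          have : 1 / δ ≤ Z := hc.trans hbig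
          rw [div_le_iff₀ hδ0] at this
          linarith
        have h3 : (ℓ : ℝ) * y ≤ (ℓ * y) * (δ * Z) := le_mul_of_one_le_right (by positivity) h2
        have h4 : ‖spLam w m j‖ ≤ ℓ * y := h1
        nlinarith
      · push Not at hc
        have h1 := spLam_le_pow w hwn m j hj
        have h2 : (Fintype.card F : ℝ) ^ j = y * y := by
          rw [hy, ← mul_pow, Real.mul_self_sqrt hq0.le]
        have h3 : y ≤ D := by
          have h4 : y = (u ^ j) ^ (1 / ε) := by
            rw [hy, hu, Real.sqrt_eq_rpow, ← Real.rpow_natCast, ← Real.rpow_natCast,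
              ← Real.rpow_mul hq0.le, ← Real.rpow_mul hq0.le, ← Real.rpow_mul hq0.le]
            congr 1; field_simp
          rw [h4, hD]
          exact Real.rpow_le_rpow (by positivity) hc.le (by positivity)
        have h5 : y * y ≤ D * y := mul_le_mul_of_nonneg_right h3 hy0.le
        have h6 : D * y ≤ D * y * Z := le_mul_of_one_le_right (by positivity) hZ1
        linarith
    · have h1 := spLam_le_half w hwn m j (by omega)
      have h2 : 2 * y ≤ 2 * y * Z := le_mul_of_one_le_right (by positivity) hZ1
      have h3 : ‖spLam w m j‖ ≤ 2 * y := h1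
      linarith
  · exact spS_zero w (Q.w_one χ) m
  · intro n
    exact sp_identity w (Q.w_one χ) (Q.w_mul χ) m n

theorem sp_final (F : Type) [Field F] [Fintype F]
    (ℓ : ℕ) (G : Type) [CommGroup G] [Fintype G] (Q : SpCls F ℓ G) (hℓ : 1 ≤ ℓ)
    (ε C0 : ℝ) (n m : ℕ) (hℓn : ℓ ≤ n)
    (hb : ∀ (χ : AddChar (Additive G) ℂ), χ ≠ 0 →
      ‖spS (Q.w χ) m n‖ ≤ (Fintype.card F : ℝ) ^ ((1 / 2 + ε) * (n : ℝ)) * Real.exp (C0 + ε * ℓ))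
    (b : F[X]) (S N : Finset F[X])
    (hS : ∀ f, f ∈ S ↔ f.Monic ∧ f.natDegree = n ∧
          ∀ w : Polynomial F, Irreducible w → w ∣ f → w.natDegree ≤ m)
    (hN : ∀ f, f ∈ N ↔ f ∈ S ∧
          ∀ i : ℕ, 1 ≤ i → i ≤ ℓ → f.coeff (n - i) = b.coeff (n - i)) :
    |(N.card : ℝ) - (S.card : ℝ) / (Fintype.card F : ℝ) ^ ℓ| ≤
      Real.exp C0 * (Fintype.card F : ℝ) ^ ((1 / 2 + ε) * (n : ℝ)) * Real.exp (ε * (ℓ : ℝ)) := by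
  classical
  have hSs : S = spSm F n m := by
    ext f; rw [hS, mem_spSm]
  obtain ⟨f0, hf1, hf2, hf3⟩ := sp_exists_monic (F := F) n ℓ hℓn (fun i => b.coeff (n - i))
  set x := Q.cls f0 with hx
  have hNs : N = S.filter (fun f => Q.cls f = x) := by
    ext f
    rw [hN, Finset.mem_filter]
    apply and_congr_right
    intro hf
    rw [hS] at hf
    rw [hx, Q.eqv_deg hℓn hf.1 hf1 hf.2.1 hf2]
    constructor
    · intro h i h1 h2; rw [h i h1 h2, hf3 i h1 h2]
    · intro h i h1 h2; rw [h i h1 h2, hf3 i h1 h2]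
  set M : ℝ := (Fintype.card F : ℝ) ^ ((1 / 2 + ε) * (n : ℝ)) * Real.exp (C0 + ε * ℓ) with hM
  have hM0 : 0 ≤ M := by positivity
  have hcard : (Fintype.card G : ℝ) = (Fintype.card F : ℝ) ^ ℓ := by
    exact_mod_cast Q.card_eq
  have hG0 : (0 : ℝ) < Fintype.card G := by exact_mod_cast Fintype.card_pos
  -- orthogonality
  have horth : (Fintype.card G : ℂ) * (N.card : ℂ) =
      ∑ χ : AddChar (Additive G) ℂ, χ (-(Additive.ofMul x)) * spS (Q.w χ) m n := by
    have h1 : (N.card : ℂ) = ∑ f ∈ S, (if Q.cls f = x then (1 : ℂ) else 0) := by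
      rw [hNs, Finset.card_filter]; push_cast; rfl
    rw [h1, Finset.mul_sum]
    simp only [spS, Finset.mul_sum]
    rw [Finset.sum_comm, ← hSs]
    apply Finset.sum_congr rfl
    intro f _
    have h2 := AddChar.sum_apply_eq_ite (α := Additive G) (Additive.ofMul (Q.cls f) - Additive.ofMul x)
    have h3 : ∀ χ : AddChar (Additive G) ℂ, χ (-(Additive.ofMul x)) * Q.w χ f =
        χ (Additive.ofMul (Q.cls f) - Additive.ofMul x) := by
      intro χ
      rw [SpCls.w, sub_eq_add_neg, AddChar.map_add_eq_mul, mul_comm]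
    rw [Finset.sum_congr rfl (fun χ _ => h3 χ), h2]
    simp only [sub_eq_zero, EmbeddingLike.apply_eq_iff_eq, mul_ite, mul_one, mul_zero,
      Fintype.card_congr (Additive.toMul (α := G))]
  have hzero : (0 : AddChar (Additive G) ℂ) (-(Additive.ofMul x)) * spS (Q.w 0) m n = S.card := by
    rw [AddChar.zero_apply, one_mul, spS, ← hSs]
    simp [SpCls.w]
  rw [← Finset.add_sum_erase _ _ (Finset.mem_univ (0 : AddChar (Additive G) ℂ)), hzero] at horth
  have h4 : ‖(Fintype.card G : ℂ) * (N.card : ℂ) - S.card‖ ≤ Fintype.card G * M := by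
    rw [horth, add_sub_cancel_left]
    have h5 : ∀ χ ∈ Finset.univ.erase (0 : AddChar (Additive G) ℂ),
        ‖χ (-(Additive.ofMul x)) * spS (Q.w χ) m n‖ ≤ M := by
      intro χ hχ
      rw [norm_mul, AddChar.norm_apply, one_mul]
      exact hb χ (Finset.mem_erase.1 hχ).1
    refine (norm_sum_le _ _).trans ((Finset.sum_le_card_nsmul _ _ _ h5).trans ?_)
    rw [nsmul_eq_mul]
    apply mul_le_mul_of_nonneg_right _ hM0
    have h6 : (Finset.univ.erase (0 : AddChar (Additive G) ℂ)).card ≤ Fintype.card G := by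
      refine (Finset.card_le_card (Finset.erase_subset _ _)).trans ?_
      rw [Finset.card_univ, AddChar.card_eq]
      exact le_of_eq (Fintype.card_congr Additive.toMul)
    exact_mod_cast h6
  have h7 : ((Fintype.card G : ℂ) * (N.card : ℂ) - S.card) =
      (((Fintype.card G : ℝ) * (N.card : ℝ) - S.card : ℝ) : ℂ) := by push_cast; rfl
  rw [h7, Complex.norm_real, Real.norm_eq_abs] at h4
  have h8 : (N.card : ℝ) - (S.card : ℝ) / (Fintype.card F : ℝ) ^ ℓ =
      ((Fintype.card G : ℝ) * (N.card : ℝ) - S.card) / Fintype.card G := by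
    rw [← hcard]; field_simp
  rw [h8, abs_div, abs_of_pos hG0, div_le_iff₀ hG0]
  refine h4.trans (le_of_eq ?_)
  rw [hM, Real.exp_add]; ring

/-- Smooth polynomials in intervals: for `0 < ε < 1/4` and `1 ≤ ℓ ≤ n`, for any
`b ∈ F_q[t]`, the number of monic `m`-smooth polynomials `f` of degree `n`
whose first `ℓ` coefficients (those of `t^{n−1},…,t^{n−ℓ}`) agree with those of
`b` equals `Ψ(n,m)/q^ℓ + O_ε(q^{(1/2+ε)n}·e^{εℓ})`. -/
theorem smooth_in_intervals :
    ∀ ε : ℝ, 0 < ε → ε < 1 / 4 → ∃ C : ℝ, 0 < C ∧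
      ∀ (Fq : Type) [Field Fq] [Fintype Fq]
        (n m ℓ : ℕ), 1 ≤ ℓ → ℓ ≤ n →
        ∀ (b : Polynomial Fq) (S N : Finset (Polynomial Fq)),
        (∀ f, f ∈ S ↔ f.Monic ∧ f.natDegree = n ∧
          ∀ w : Polynomial Fq, Irreducible w → w ∣ f → w.natDegree ≤ m) →
        (∀ f, f ∈ N ↔ f ∈ S ∧
          ∀ i : ℕ, 1 ≤ i → i ≤ ℓ → f.coeff (n - i) = b.coeff (n - i)) →
        |(N.card : ℝ) - (S.card : ℝ) / (Fintype.card Fq : ℝ) ^ ℓ| ≤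
          C * (Fintype.card Fq : ℝ) ^ ((1 / 2 + ε) * (n : ℝ)) *
            Real.exp (ε * (ℓ : ℝ)) := by
  intro ε hε _
  obtain ⟨C0, hC0⟩ := sp_char_bound ε hε
  refine ⟨Real.exp C0, Real.exp_pos _, ?_⟩
  intro F _ _ n m ℓ hℓ hℓn b S N hS hN
  obtain ⟨G, _, _, ⟨Q⟩⟩ := sp_group F ℓ
  haveI := Fintype.ofFinite G
  exact sp_final F ℓ G Q hℓ ε C0 n m hℓn (fun χ hχ => hC0 F ℓ G Q hℓ χ hχ n m) b S N hS hN
end
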